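/- arXiv:2305.05742 — 2 statements merged into one kernel-verified Lean document; each statement's English description precedes it below -/
import Mathlib

section
/- Let T_0 ⊂ ℝ^d be a Kuhn simplex, taken as colored initial triangulation 𝒯_0 = {T_0}, let 𝒯 ∈ Bisec({T_0}) and v ∈ 𝒱(𝒯). Then gen#(e) − gen#(e') ≤ 2d for all edges e, e' ∈ ℰ(𝒯) with v ∈ e ∩ e'. In case of equality the types type#(e) = type#(e') coincide, and if moreover type#(e) ∈ {1, d}, then the edge e' is uniquely determined by e and vice versa. -/
noncomputable section

namespace BisecGrading

/-- Points of `ℝ^d`. -/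
abbrev Pt (d : ℕ) : Type := Fin d → ℝ

/-- Integer ceiling `⌈g / d⌉` (for `d > 0`). -/
def lvlZ (d : ℕ) (g : ℤ) : ℤ := (g + d - 1) / d

/-- The type `g - d * (⌈g/d⌉ - 1)` of a generation `g`. -/
def typZ (d : ℕ) (g : ℤ) : ℤ := g - d * (lvlZ d g - 1)

/-- A `d`-simplex, given by its ordered vertex list (in Maubach's ordering) together
with its generation counter. -/
structure Simplex (d : ℕ) where
  vertex : Fin (d + 1) → Pt d
  gen : ℕ

namespace Simplex

variable {d : ℕ}

instance : DecidableEq (Simplex d) := Classical.decEq _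

/-- Maubach's index `k = d - (gen T % d)`. -/
def k (T : Simplex d) : ℕ := d - T.gen % d

lemma k_le (T : Simplex d) : T.k ≤ d := Nat.sub_le _ _

/-- `k` as an index into the vertex list. -/
def kIdx (T : Simplex d) : Fin (d + 1) := ⟨T.k, Nat.lt_succ_of_le T.k_le⟩

/-- The bisection vertex `(v₀ + v_k)/2`. -/
def bsv (T : Simplex d) : Pt d := midpoint ℝ (T.vertex 0) (T.vertex T.kIdx)

/-- The bisection edge `[v₀, v_k]`, as an unordered pair of points. -/
def bse (T : Simplex d) : Sym2 (Pt d) := s(T.vertex 0, T.vertex T.kIdx)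

/-- The first child `[v₀, …, v_{k-1}, v', v_{k+1}, …, v_d]` of Maubach's bisection. -/
def child1 (T : Simplex d) : Simplex d where
  vertex := Function.update T.vertex T.kIdx T.bsv
  gen := T.gen + 1

/-- The second child `[v₁, …, v_k, v', v_{k+1}, …, v_d]` of Maubach's bisection. -/
def child2 (T : Simplex d) : Simplex d where
  vertex := fun i =>
    if h : (i : ℕ) < T.k then
      T.vertex ⟨(i : ℕ) + 1, by have hk := T.k_le; omega⟩
    else if (i : ℕ) = T.k then T.bsv
    else T.vertex i
  gen := T.gen + 1

/-- `T'` is a child of `T`. -/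
def IsChild (T' T : Simplex d) : Prop := T' = T.child1 ∨ T' = T.child2

/-- The vertex set `𝒱(T)`. -/
def V (T : Simplex d) : Set (Pt d) := Set.range T.vertex

/-- The edge set `ℰ(T)`. -/
def E (T : Simplex d) : Set (Sym2 (Pt d)) :=
  {e | ∃ i j : Fin (d + 1), i ≠ j ∧ e = s(T.vertex i, T.vertex j)}

/-- The closed simplex (convex hull of the vertices). -/
def hull (T : Simplex d) : Set (Pt d) := convexHull ℝ (Set.range T.vertex)

/-- The level `⌈gen/d⌉` of a `d`-simplex. -/
def lvl (T : Simplex d) : ℤ := lvlZ d T.gen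

/-- The type of a `d`-simplex. -/
def typ (T : Simplex d) : ℤ := typZ d T.gen

end Simplex

variable {d : ℕ}

/-- Membership in the master tree generated from the initial triangulation `T0`. -/
inductive MemM (T0 : Finset (Simplex d)) : Simplex d → Prop
  | init {T : Simplex d} : T ∈ T0 → MemM T0 T
  | child {T T' : Simplex d} : MemM T0 T → T'.IsChild T → MemM T0 T'

/-- `Refines 𝒯₁ 𝒯₂` : the partition `𝒯₂` is obtained from `𝒯₁` by finitely many
single bisections. -/
inductive Refines : Finset (Simplex d) → Finset (Simplex d) → Prop
  | refl (𝒯 : Finset (Simplex d)) : Refines 𝒯 𝒯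
  | step {𝒯₁ 𝒯₂ : Finset (Simplex d)} (T : Simplex d) :
      Refines 𝒯₁ 𝒯₂ → T ∈ 𝒯₂ →
      Refines 𝒯₁ (insert T.child1 (insert T.child2 (𝒯₂.erase T)))

/-- The subsimplex of `T` spanned by the vertex positions in `s`. -/
def faceSet (T : Simplex d) (s : Finset (Fin (d + 1))) : Set (Pt d) :=
  convexHull ℝ (T.vertex '' ↑s)

/-- Conformity: any two simplices meet in the empty set or in a common subsimplex. -/
def Conforming (𝒯 : Finset (Simplex d)) : Prop :=
  ∀ T₁ ∈ 𝒯, ∀ T₂ ∈ 𝒯,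
    T₁.hull ∩ T₂.hull = ∅ ∨
      ∃ s₁ s₂ : Finset (Fin (d + 1)), s₁.Nonempty ∧ s₂.Nonempty ∧
        T₁.hull ∩ T₂.hull = faceSet T₁ s₁ ∧ T₁.hull ∩ T₂.hull = faceSet T₂ s₂

/-- The conforming triangulations obtained from `T0` by successive bisections. -/
def Bisec (T0 : Finset (Simplex d)) : Set (Finset (Simplex d)) :=
  {𝒯 | Refines T0 𝒯 ∧ Conforming 𝒯}

/-- All vertices of a triangulation. -/
def verticesOf (𝒯 : Finset (Simplex d)) : Set (Pt d) := ⋃ T ∈ 𝒯, T.V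

/-- All edges of a triangulation. -/
def edgesOf (𝒯 : Finset (Simplex d)) : Set (Sym2 (Pt d)) := ⋃ T ∈ 𝒯, T.E

/-- Midpoint of an edge; this is the bisection vertex of the edge. -/
def edgeMid (e : Sym2 (Pt d)) : Pt d :=
  Sym2.lift ⟨fun a b => midpoint ℝ a b, fun a b => midpoint_comm a b⟩ e

/-- The closed segment covered by an edge. -/
def edgeSeg (e : Sym2 (Pt d)) : Set (Pt d) :=
  Sym2.lift ⟨fun a b => segment ℝ a b, fun a b => segment_symm ℝ a b⟩ e

/-- A colored conforming initial triangulation (with the vertices of each initial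
simplex ordered so that the colors read `(d, 0, 1, …, d-1)`), together with the
induced generation function on all vertices of the master tree. -/
structure ColoredSetup (d : ℕ) where
  T0 : Finset (Simplex d)
  indep : ∀ T ∈ T0, AffineIndependent ℝ T.vertex
  gen_zero : ∀ T ∈ T0, T.gen = 0
  conf : Conforming T0
  disjInt : ∀ T₁ ∈ T0, ∀ T₂ ∈ T0, T₁ ≠ T₂ → interior T₁.hull ∩ interior T₂.hull = ∅
  color : Pt d → ℕ
  color_zero : ∀ T ∈ T0, color (T.vertex 0) = d
  color_succ : ∀ T ∈ T0, ∀ i : Fin (d + 1), (i : ℕ) ≠ 0 → color (T.vertex i) = (i : ℕ) - 1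
  vgen : Pt d → ℤ
  vgen_init : ∀ T ∈ T0, ∀ i : Fin (d + 1), vgen (T.vertex i) = -(color (T.vertex i) : ℤ)
  vgen_bsv : ∀ T : Simplex d, MemM T0 T → vgen T.bsv = (T.gen : ℤ) + 1

namespace ColoredSetup

variable {d : ℕ} (S : ColoredSetup d)

/-- Level of a vertex. -/
def lvlV (v : Pt d) : ℤ := lvlZ d (S.vgen v)

/-- Type of a vertex. -/
def typV (v : Pt d) : ℤ := typZ d (S.vgen v)

/-- Generation of an edge: the maximal generation of its endpoints. -/
def genE (e : Sym2 (Pt d)) : ℤ :=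
  Sym2.lift ⟨fun a b => max (S.vgen a) (S.vgen b), fun a b => max_comm _ _⟩ e

/-- Level of an edge. -/
def lvlE (e : Sym2 (Pt d)) : ℤ := lvlZ d (S.genE e)

/-- Type of an edge. -/
def typE (e : Sym2 (Pt d)) : ℤ := typZ d (S.genE e)

/-- `gen#` of an edge: the generation of its bisection vertex (= its midpoint). -/
def genSharpE (e : Sym2 (Pt d)) : ℤ := S.vgen (edgeMid e)

/-- `level#` of an edge. -/
def lvlSharpE (e : Sym2 (Pt d)) : ℤ := lvlZ d (S.genSharpE e)

/-- `type#` of an edge. -/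
def typSharpE (e : Sym2 (Pt d)) : ℤ := typZ d (S.genSharpE e)

end ColoredSetup

/-- Chains of pairwise intersecting simplices of length `N`. -/
def IsSimChain (𝒮 : Set (Simplex d)) (T T' : Simplex d) (N : ℕ) : Prop :=
  ∃ f : Fin (N + 1) → Simplex d, (∀ i, f i ∈ 𝒮) ∧ f 0 = T ∧ f (Fin.last N) = T' ∧
    ∀ i : Fin N, ((f i.castSucc).hull ∩ (f i.succ).hull).Nonempty

/-- The simplex distance `δ_𝒯`. -/
def simDist (𝒯 : Finset (Simplex d)) (T T' : Simplex d) : ℕ :=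
  sInf {N | IsSimChain (↑𝒯) T T' N}

/-- Chains of `1`-neighbours (consecutive simplices share an edge). -/
def Is1Chain (𝒮 : Set (Simplex d)) (T T' : Simplex d) (N : ℕ) : Prop :=
  ∃ f : Fin (N + 1) → Simplex d, (∀ i, f i ∈ 𝒮) ∧ f 0 = T ∧ f (Fin.last N) = T' ∧
    ∀ i : Fin N, ((f i.castSucc).E ∩ (f i.succ).E).Nonempty

/-- The `1`-distance `δ¹_𝒮`. -/
def dist1 (𝒮 : Set (Simplex d)) (T T' : Simplex d) : ℕ :=
  sInf {N | Is1Chain 𝒮 T T' N}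

/-- The uniform patch `ω_{𝒯₀⁺}(v)` in the full uniform refinement `𝒯₀⁺`. -/
def patchPlus (S : ColoredSetup d) (v : Pt d) : Set (Simplex d) :=
  {T | MemM S.T0 T ∧ T.gen = d ∧ v ∈ T.V}

/-- The constant `C(𝒯₀)`. -/
def Cconst (S : ColoredSetup d) : ℕ :=
  sSup {n | ∃ v ∈ verticesOf S.T0, ∃ T ∈ patchPlus S v, ∃ T' ∈ patchPlus S v,
    n = dist1 (patchPlus S v) T T'}

/-- `v` lies in some `n`-subsimplex of an initial simplex. -/
def InMacroSub (S : ColoredSetup d) (n : ℕ) (v : Pt d) : Prop :=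
  ∃ T ∈ S.T0, ∃ s : Finset (Fin (d + 1)), s.card = n + 1 ∧ v ∈ convexHull ℝ (T.vertex '' ↑s)

/-- `v` is an `n`-macro vertex. -/
def IsMacro (S : ColoredSetup d) (n : ℕ) (v : Pt d) : Prop :=
  InMacroSub S n v ∧ ∀ m : ℕ, m < n → ¬ InMacroSub S m v

/-- The maximal level jump at a vertex `v`. -/
def jump (S : ColoredSetup d) (v : Pt d) : ℕ :=
  sSup {n | ∃ 𝒯 ∈ Bisec S.T0, ∃ e ∈ edgesOf 𝒯, ∃ e' ∈ edgesOf 𝒯,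
    v ∈ e ∧ v ∈ e' ∧ (n : ℤ) = |S.lvlE e - S.lvlE e'|}

/-- The constants `J_n`. -/
def J (S : ColoredSetup d) (n : ℕ) : ℤ :=
  if n = 0 then ⌈((Cconst S : ℚ) + 1) * (1 - 1 / (d : ℚ))⌉ - 2
  else if n ≤ d - 2 then 2 else 0

/-- The constant `Γ = 1 + Σ_{n=0}^{d-2} J_n`. -/
def Gam (S : ColoredSetup d) : ℤ := 1 + ∑ n ∈ Finset.range (d - 1), J S n

/-- The edges spanned by a set of points. -/
def edgeOfSet (A : Set (Pt d)) : Set (Sym2 (Pt d)) :=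
  {e | ∃ a ∈ A, ∃ b ∈ A, a ≠ b ∧ e = s(a, b)}

/-- `FirstBisected A T e` : along descendants of `T` that keep all points of `A` as
vertices, `e` is the first edge spanned by points of `A` which occurs as a bisection
edge, i.e. the edge of the subsimplex spanned by `A` that is bisected first. -/
inductive FirstBisected (A : Set (Pt d)) : Simplex d → Sym2 (Pt d) → Prop
  | found {T : Simplex d} : T.bse ∈ edgeOfSet A → FirstBisected A T T.bse
  | step {T T' : Simplex d} {e : Sym2 (Pt d)} :
      T.bse ∉ edgeOfSet A → T'.IsChild T → A ⊆ T'.V →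
      FirstBisected A T' e → FirstBisected A T e

/-- The uniform vertex patch `ω_m(v)`. -/
def patchU (S : ColoredSetup d) (m : ℕ) (v : Pt d) : Set (Simplex d) :=
  {T | MemM S.T0 T ∧ T.gen = m * d ∧ v ∈ T.V}

/-- The patch boundary `∂ω_m(v)`: union of the `(d-1)`-subsimplices of members of
`ω_m(v)` not containing `v`. -/
def patchBd (S : ColoredSetup d) (m : ℕ) (v : Pt d) : Set (Pt d) :=
  ⋃ T ∈ patchU S m v,
    ⋃ s ∈ {s : Finset (Fin (d + 1)) | s.card = d ∧ v ∉ convexHull ℝ (T.vertex '' ↑s)},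
      convexHull ℝ (T.vertex '' ↑s)

/-- The neighbourhood `Ω_m(v)`. -/
def nbhd (S : ColoredSetup d) (m : ℕ) (v : Pt d) : Set (Pt d) :=
  (⋃ T ∈ patchU S m v, T.hull) \ patchBd S m v

/-- The Kuhn simplex `T_π = [0, e_{π(1)}, e_{π(1)}+e_{π(2)}, …]`, of generation `0`. -/
def kuhnSimplex (d : ℕ) (π : Equiv.Perm (Fin d)) : Simplex d where
  vertex := fun i x => if ((π.symm x : ℕ)) < (i : ℕ) then 1 else 0
  gen := 0

/-- The average diameter `h₀` of the initial triangulation. -/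
def avgDiam (T0 : Finset (Simplex d)) : ℝ :=
  (∑ T ∈ T0, Metric.diam T.hull) / T0.card

/-- The regularized mesh size function `h_𝒯`. -/
def regMesh (T0 𝒯 : Finset (Simplex d)) (T : Simplex d) : ℝ :=
  avgDiam T0 * sInf {x : ℝ | ∃ T' ∈ 𝒯, x = (2 : ℝ) ^ (-(T'.lvl) + (simDist 𝒯 T T' : ℤ))}

/-! ### Combinatorics of the master tree -/

namespace Simplex

lemma one_le_k (hd : 0 < d) (T : Simplex d) : 1 ≤ T.k := by
  have := Nat.mod_lt T.gen hd
  unfold k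
  omega

@[simp] lemma kIdx_val (T : Simplex d) : (T.kIdx : ℕ) = T.k := rfl

@[simp] lemma child1_gen (T : Simplex d) : T.child1.gen = T.gen + 1 := rfl

@[simp] lemma child2_gen (T : Simplex d) : T.child2.gen = T.gen + 1 := rfl

lemma IsChild.gen {T T' : Simplex d} (h : T'.IsChild T) : T'.gen = T.gen + 1 := by
  rcases h with rfl | rfl <;> rfl

lemma child1_vertex_k (T : Simplex d) : T.child1.vertex T.kIdx = T.bsv := by
  simp [child1]

lemma child1_vertex_of_ne (T : Simplex d) {i : Fin (d + 1)} (h : (i : ℕ) ≠ T.k) :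
    T.child1.vertex i = T.vertex i := by
  have : i ≠ T.kIdx := fun h' => h (by rw [h', kIdx_val])
  simp [child1, this]

lemma child2_vertex_k (T : Simplex d) : T.child2.vertex T.kIdx = T.bsv := by
  simp [child2]

lemma child2_vertex_lt (T : Simplex d) {i j : Fin (d + 1)} (h : (i : ℕ) < T.k)
    (hj : (j : ℕ) = i + 1) : T.child2.vertex i = T.vertex j := by
  have : j = ⟨(i : ℕ) + 1, by have hk := T.k_le; omega⟩ := Fin.ext hj
  simp [child2, h, this]

lemma child2_vertex_gt (T : Simplex d) {i : Fin (d + 1)} (h : T.k < (i : ℕ)) :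
    T.child2.vertex i = T.vertex i := by
  simp [child2, h.not_gt, h.ne']

lemma vertex_mem_hull (T : Simplex d) (i : Fin (d + 1)) : T.vertex i ∈ T.hull :=
  subset_convexHull ℝ _ ⟨i, rfl⟩

lemma hull_convex (T : Simplex d) : Convex ℝ T.hull := convex_convexHull ℝ _

lemma bsv_mem_hull (T : Simplex d) : T.bsv ∈ T.hull :=
  T.hull_convex.midpoint_mem (T.vertex_mem_hull _) (T.vertex_mem_hull _)

lemma bsv_mem_V_of_isChild {T T' : Simplex d} (h : T'.IsChild T) : T.bsv ∈ T'.V := by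
  rcases h with rfl | rfl
  · exact ⟨_, T.child1_vertex_k⟩
  · exact ⟨_, T.child2_vertex_k⟩

lemma IsChild.vertex_mem {T T' : Simplex d} (h : T'.IsChild T) (i : Fin (d + 1)) :
    T'.vertex i = T.bsv ∨ ∃ j, T'.vertex i = T.vertex j := by
  rcases eq_or_ne (i : ℕ) T.k with hi | hi
  · have : i = T.kIdx := Fin.ext hi
    subst this
    rcases h with rfl | rfl
    · exact Or.inl T.child1_vertex_k
    · exact Or.inl T.child2_vertex_k
  · right
    rcases h with rfl | rfl
    · exact ⟨i, T.child1_vertex_of_ne hi⟩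
    · rcases hi.lt_or_gt with hi | hi
      · exact ⟨⟨i + 1, by have := T.k_le; omega⟩, T.child2_vertex_lt hi rfl⟩
      · exact ⟨i, T.child2_vertex_gt hi⟩

lemma IsChild.hull_subset {T T' : Simplex d} (h : T'.IsChild T) : T'.hull ⊆ T.hull := by
  refine convexHull_min ?_ T.hull_convex
  rintro _ ⟨i, rfl⟩
  rcases h.vertex_mem i with hi | ⟨j, hi⟩
  · exact hi ▸ T.bsv_mem_hull
  · exact hi ▸ T.vertex_mem_hull j

lemma V_subset_children (hd : 0 < d) (T : Simplex d) : T.V ⊆ T.child1.V ∪ T.child2.V := by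
  rintro _ ⟨i, rfl⟩
  rcases eq_or_ne (i : ℕ) T.k with hi | hi
  · right
    have hk := T.one_le_k hd
    exact ⟨⟨i - 1, by omega⟩, T.child2_vertex_lt (by simp; omega) (by simp; omega)⟩
  · exact Or.inl ⟨i, T.child1_vertex_of_ne hi⟩

lemma IsChild.affineIndependent (hd : 0 < d) {T T' : Simplex d} (h : T'.IsChild T)
    (hT : AffineIndependent ℝ T.vertex) : AffineIndependent ℝ T'.vertex := by
  have hcard : Fintype.card (Fin (d + 1)) = d + 1 := by simp
  rw [affineIndependent_iff_finrank_vectorSpan_eq ℝ _ hcard]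
  have htop : affineSpan ℝ (Set.range T.vertex) = ⊤ := by
    rw [hT.affineSpan_eq_top_iff_card_eq_finrank_add_one]
    simp
  have hsub : affineSpan ℝ (Set.range T.vertex) ≤ affineSpan ℝ (Set.range T'.vertex) := by
    have h0k : T.vertex 0 ∈ affineSpan ℝ (Set.range T'.vertex) ∧
        T.vertex T.kIdx ∈ affineSpan ℝ (Set.range T'.vertex) ∧
        ∀ i : Fin (d + 1), (i : ℕ) ≠ 0 → (i : ℕ) ≠ T.k →
          T.vertex i ∈ affineSpan ℝ (Set.range T'.vertex) := by
      have hb : T.bsv ∈ affineSpan ℝ (Set.range T'.vertex) :=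
        subset_affineSpan ℝ _ (bsv_mem_V_of_isChild h)
      have hk := T.one_le_k hd
      rcases h with rfl | rfl
      · have h0 : T.vertex 0 ∈ affineSpan ℝ (Set.range T.child1.vertex) :=
          subset_affineSpan ℝ _ ⟨0, T.child1_vertex_of_ne (by simp; omega)⟩
        refine ⟨h0, ?_, fun i _ hi => subset_affineSpan ℝ _ ⟨i, T.child1_vertex_of_ne hi⟩⟩
        have := AffineMap.lineMap_mem (2 : ℝ) h0 hb
        convert this using 1
        ext x
        simp [bsv, AffineMap.lineMap_apply, midpoint_eq_smul_add]
        ring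
      · have h1 : T.vertex T.kIdx ∈ affineSpan ℝ (Set.range T.child2.vertex) :=
          subset_affineSpan ℝ _ ⟨⟨T.k - 1, by have := T.k_le; omega⟩,
            T.child2_vertex_lt (by simp; omega) (by simp; omega)⟩
        refine ⟨?_, h1, fun i hi0 hi => subset_affineSpan ℝ _ ?_⟩
        · have := AffineMap.lineMap_mem (2 : ℝ) h1 hb
          convert this using 1
          ext x
          simp [bsv, AffineMap.lineMap_apply, midpoint_eq_smul_add]
          ring
        · rcases hi.lt_or_gt with hi | hi
          · exact ⟨⟨i - 1, by omega⟩, T.child2_vertex_lt (by simp; omega) (by simp; omega)⟩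
          · exact ⟨i, T.child2_vertex_gt hi⟩
    rw [affineSpan_le]
    rintro _ ⟨i, rfl⟩
    rcases eq_or_ne (i : ℕ) 0 with hi | hi
    · rw [show i = 0 from Fin.ext hi]
      exact h0k.1
    rcases eq_or_ne (i : ℕ) T.k with hi' | hi'
    · rw [show i = T.kIdx from Fin.ext hi']
      exact h0k.2.1
    · exact h0k.2.2 i hi hi'
  have htop' : affineSpan ℝ (Set.range T'.vertex) = ⊤ := top_le_iff.mp (htop ▸ hsub)
  rw [← direction_affineSpan, htop', AffineSubspace.direction_top]
  simp

/-- A simplex is covered by its two children. -/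
lemma hull_subset_children (hd : 0 < d) (T : Simplex d) :
    T.hull ⊆ T.child1.hull ∪ T.child2.hull := by
  intro p hp
  have hk := T.one_le_k hd
  have hne : (0 : Fin (d + 1)) ≠ T.kIdx := fun h => by
    have := congrArg Fin.val h
    simp at this
    omega
  obtain ⟨w, hw0, hw1, rfl⟩ : ∃ w : Fin (d + 1) → ℝ, (∀ i, 0 ≤ w i) ∧ ∑ i, w i = 1 ∧
      ∑ i, w i • T.vertex i = p := by
    refine convexHull_min (t := {p | ∃ w : Fin (d + 1) → ℝ, (∀ i, 0 ≤ w i) ∧ ∑ i, w i = 1 ∧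
      ∑ i, w i • T.vertex i = p}) ?_ ?_ hp
    · rintro _ ⟨i, rfl⟩
      refine ⟨Pi.single i 1, fun j => ?_, by simp, by simp [Pi.single_apply]⟩
      by_cases h : j = i <;> simp [h]
    · rintro _ ⟨w, hw0, hw1, rfl⟩ _ ⟨w', hw0', hw1', rfl⟩ a b ha hb hab
      refine ⟨fun i => a * w i + b * w' i, fun i => ?_, ?_, ?_⟩
      · have := hw0 i
        have := hw0' i
        positivity
      · rw [Finset.sum_add_distrib, ← Finset.mul_sum, ← Finset.mul_sum, hw1, hw1']
        linarith
      · simp only [add_smul, Finset.sum_add_distrib, mul_smul, Finset.smul_sum]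
  have key : ∀ (C : Set (Pt d)), Convex ℝ C → ∀ i j : Fin (d + 1), i ≠ j → w j ≤ w i →
      (∀ l, l ≠ j → T.vertex l ∈ C) → midpoint ℝ (T.vertex i) (T.vertex j) ∈ C →
      ∑ l, w l • T.vertex l ∈ C := by
    intro C hC i j hij hle hv hm
    let w' : Fin (d + 1) → ℝ := fun l => if l = j then 2 * w j else if l = i then w i - w j else w l
    let u : Fin (d + 1) → Pt d := fun l =>
      if l = j then midpoint ℝ (T.vertex i) (T.vertex j) else T.vertex l
    have e1 : ∑ l, w' l = ∑ l, w l := by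
      have : ∀ l, w' l = w l + (if l = j then w j else 0) - (if l = i then w j else 0) := by
        intro l
        simp only [w']
        split_ifs with h1 h2 h2
        · exact absurd (h2.symm.trans h1) hij
        · rw [h1]; ring
        · rw [h2]; ring
        · ring
      simp only [this, Finset.sum_sub_distrib, Finset.sum_add_distrib]
      simp
    have e2 : ∑ l, w' l • u l = ∑ l, w l • T.vertex l := by
      have : ∀ l, w' l • u l = w l • T.vertex l + (if l = j then w j • T.vertex i else 0)
          - (if l = i then w j • T.vertex i else 0) := by
        intro l
        simp only [w', u]
        split_ifs with h1 h2 h2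
        · exact absurd (h2.symm.trans h1) hij
        · subst h1
          ext x
          simp [midpoint_eq_smul_add]
          ring
        · subst h2
          ext x
          simp
          ring
        · simp
      simp only [this, Finset.sum_sub_distrib, Finset.sum_add_distrib]
      simp
    rw [← e2]
    refine hC.sum_mem (fun l _ => ?_) (e1.trans hw1) (fun l _ => ?_)
    · have := hw0 l
      have := hw0 j
      simp only [w']
      split_ifs <;> linarith
    · simp only [u]
      split_ifs with h
      · exact hm
      · exact hv l h
  rcases le_total (w T.kIdx) (w 0) with h | h
  · left
    refine key _ T.child1.hull_convex 0 T.kIdx hne h (fun l hl => ?_) ?_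
    · rw [← T.child1_vertex_of_ne fun h => hl (Fin.ext h)]
      exact vertex_mem_hull _ _
    · have := T.child1.vertex_mem_hull T.kIdx
      rwa [T.child1_vertex_k] at this
  · right
    refine key _ T.child2.hull_convex T.kIdx 0 hne.symm h (fun l hl => ?_) ?_
    · have hl0 : (l : ℕ) ≠ 0 := fun h => hl (Fin.ext h)
      rcases lt_or_ge T.k (l : ℕ) with h | h
      · rw [← T.child2_vertex_gt h]
        exact vertex_mem_hull _ _
      · rw [← T.child2_vertex_lt (i := ⟨l - 1, by omega⟩) (by simp; omega) (by simp; omega)]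
        exact vertex_mem_hull _ _
    · rw [midpoint_comm]
      have := T.child2.vertex_mem_hull T.kIdx
      rwa [T.child2_vertex_k] at this

end Simplex

lemma Simplex.vertex_mem_extremePoints {T : Simplex d} (hT : AffineIndependent ℝ T.vertex)
    (i : Fin (d + 1)) : T.vertex i ∈ T.hull.extremePoints ℝ := by
  let b : AffineBasis (Fin (d + 1)) ℝ (Pt d) :=
    ⟨T.vertex, hT, by rw [hT.affineSpan_eq_top_iff_card_eq_finrank_add_one]; simp⟩
  have hb : T.hull = {x | ∀ i, 0 ≤ b.coord i x} := b.convexHull_eq_nonneg_coord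
  refine ⟨T.vertex_mem_hull i, ?_⟩
  rintro x hx y hy ⟨α, β, hα, hβ, hαβ, hxy⟩
  rw [hb] at hx hy
  have h0 : ∀ j, j ≠ i → b.coord j x = 0 := by
    intro j hj
    have h1 : b.coord j (T.vertex i) = 0 := b.coord_apply_ne hj
    have h2 : b.coord j (α • x + β • y) = α * b.coord j x + β * b.coord j y := by
      rw [Convex.combo_affine_apply hαβ]
      simp
    rw [hxy, h1] at h2
    have h3 := mul_nonneg hα.le (hx j)
    have h4 := mul_nonneg hβ.le (hy j)
    have h5 : α * b.coord j x = 0 := by linarith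
    simpa [hα.ne'] using h5
  refine b.ext_elem fun j => ?_
  rcases eq_or_ne j i with rfl | hj
  · have h1 := b.sum_coord_apply_eq_one x
    rw [Finset.sum_eq_single j (fun l _ hl => h0 l hl) (by simp)] at h1
    rw [h1]
    exact (b.coord_apply_eq j).symm
  · rw [h0 j hj]
    exact (b.coord_apply_ne hj).symm

lemma Conforming.mem_V {𝒯 : Finset (Simplex d)} (h𝒯 : Conforming 𝒯) {T₁ T₂ : Simplex d}
    (h₁ : T₁ ∈ 𝒯) (h₂ : T₂ ∈ 𝒯) (hi : AffineIndependent ℝ T₁.vertex) {z : Pt d}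
    (hz₁ : z ∈ T₁.V) (hz₂ : z ∈ T₂.hull) : z ∈ T₂.V := by
  obtain ⟨i, rfl⟩ := hz₁
  have hz : T₁.vertex i ∈ T₁.hull ∩ T₂.hull := ⟨T₁.vertex_mem_hull i, hz₂⟩
  rcases h𝒯 T₁ h₁ T₂ h₂ with h | ⟨s₁, s₂, -, -, -, h⟩
  · simp [h] at hz
  · have hext := inter_extremePoints_subset_extremePoints_of_subset
      (𝕜 := ℝ) (Set.inter_subset_left (s := T₁.hull) (t := T₂.hull))
      ⟨hz, T₁.vertex_mem_extremePoints hi i⟩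
    rw [h] at hext
    obtain ⟨j, -, hj⟩ := extremePoints_convexHull_subset hext
    exact ⟨j, hj⟩

lemma MemM.exists_root {A : Finset (Simplex d)} {T : Simplex d} (h : MemM A T) :
    ∃ R ∈ A, MemM {R} T := by
  induction h with
  | init h => exact ⟨_, h, .init (by simp)⟩
  | child _ hc ih =>
    obtain ⟨R, hR, hT⟩ := ih
    exact ⟨R, hR, hT.child hc⟩

lemma MemM.eq_or_child {R T : Simplex d} (h : MemM {R} T) :
    T = R ∨ MemM {R.child1} T ∨ MemM {R.child2} T := by
  induction h with
  | init h => exact Or.inl (by simpa using h)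
  | child _ hc ih =>
    right
    rcases ih with rfl | h | h
    · rcases hc with rfl | rfl
      · exact Or.inl (.init (by simp))
      · exact Or.inr (.init (by simp))
    · exact Or.inl (h.child hc)
    · exact Or.inr (h.child hc)

lemma MemM.hull_subset {R T : Simplex d} (h : MemM {R} T) : T.hull ⊆ R.hull := by
  induction h with
  | init h => rw [Finset.mem_singleton.mp h]
  | child _ hc ih => exact hc.hull_subset.trans ih

lemma MemM.gen_le {R T : Simplex d} (h : MemM {R} T) : R.gen ≤ T.gen := by
  induction h with
  | init h => rw [Finset.mem_singleton.mp h]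
  | child _ hc ih => rw [hc.gen]; omega

lemma MemM.affineIndependent (hd : 0 < d) {A : Finset (Simplex d)}
    (hA : ∀ T ∈ A, AffineIndependent ℝ T.vertex) {T : Simplex d} (h : MemM A T) :
    AffineIndependent ℝ T.vertex := by
  induction h with
  | init h => exact hA _ h
  | child _ hc ih => exact hc.affineIndependent hd ih

lemma ColoredSetup.vgen_vertex_le (S : ColoredSetup d) {T : Simplex d} (h : MemM S.T0 T)
    (i : Fin (d + 1)) : S.vgen (T.vertex i) ≤ T.gen := by
  induction h generalizing i with
  | init h =>
    rw [S.vgen_init _ h]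
    omega
  | child hT hc ih =>
    rw [hc.gen]
    rcases hc.vertex_mem i with h | ⟨j, h⟩ <;> rw [h]
    · rw [S.vgen_bsv _ hT]
      simp
    · have := ih j
      push_cast
      omega

/-- Every point of a simplex lies in some descendant of any larger generation. -/
lemma exists_descendant (hd : 0 < d) {R : Simplex d} {p : Pt d} (hp : p ∈ R.hull) {g : ℕ}
    (hg : R.gen ≤ g) : ∃ T, MemM {R} T ∧ T.gen = g ∧ p ∈ T.hull := by
  induction g, hg using Nat.le_induction with
  | base => exact ⟨R, .init (by simp), rfl, hp⟩
  | succ g _ ih =>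
    obtain ⟨T, hT, hTg, hpT⟩ := ih
    rcases T.hull_subset_children hd hpT with h | h
    · exact ⟨T.child1, hT.child (Or.inl rfl), by simp [hTg], h⟩
    · exact ⟨T.child2, hT.child (Or.inr rfl), by simp [hTg], h⟩

lemma mem_verticesOf {𝒯 : Finset (Simplex d)} {z : Pt d} :
    z ∈ verticesOf 𝒯 ↔ ∃ T ∈ 𝒯, z ∈ T.V := by
  simp [verticesOf]

lemma Refines.memM {A 𝒯 : Finset (Simplex d)} (h : Refines A 𝒯) {T : Simplex d} (hT : T ∈ 𝒯) :
    MemM A T := by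
  induction h generalizing T with
  | refl => exact .init hT
  | step R _ hR ih =>
    simp only [Finset.mem_insert, Finset.mem_erase] at hT
    rcases hT with rfl | rfl | ⟨-, hT⟩
    · exact (ih hR).child (Or.inl rfl)
    · exact (ih hR).child (Or.inr rfl)
    · exact ih hT

/-- A simplex of the master tree is either not subdivided by a partition, or all its vertices
are vertices of the partition. -/
lemma Refines.ancestor_or_V_subset (hd : 0 < d) {A 𝒯 : Finset (Simplex d)} (h : Refines A 𝒯)
    {T : Simplex d} (hT : MemM A T) : (∃ R ∈ 𝒯, MemM {R} T) ∨ T.V ⊆ verticesOf 𝒯 := by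
  induction h with
  | refl => exact Or.inl hT.exists_root
  | @step 𝒯₂ R hR hmem ih =>
    have hmono : verticesOf 𝒯₂ ⊆
        verticesOf (insert R.child1 (insert R.child2 (𝒯₂.erase R))) := by
      intro z hz
      obtain ⟨Q, hQ, hzQ⟩ := mem_verticesOf.mp hz
      rw [mem_verticesOf]
      rcases eq_or_ne Q R with rfl | hne
      · rcases Q.V_subset_children hd hzQ with h | h
        · exact ⟨_, by simp, h⟩
        · exact ⟨_, by simp, h⟩
      · exact ⟨Q, by simp [hne, hQ], hzQ⟩
    rcases ih with ⟨Q, hQ, hQT⟩ | h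
    · rcases eq_or_ne Q R with rfl | hne
      · rcases hQT.eq_or_child with rfl | h | h
        · exact Or.inr fun z hz => hmono (mem_verticesOf.mpr ⟨_, hQ, hz⟩)
        · exact Or.inl ⟨_, by simp, h⟩
        · exact Or.inl ⟨_, by simp, h⟩
      · exact Or.inl ⟨Q, by simp [hne, hQ], hQT⟩
    · exact Or.inr (h.trans hmono)

/-- If the bisection vertex of a simplex is a vertex of a conforming triangulation, then so are
all vertices of the simplex. -/
lemma V_subset_of_bsv_mem (hd : 0 < d) (S : ColoredSetup d) {𝒯 : Finset (Simplex d)}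
    (h𝒯 : 𝒯 ∈ Bisec S.T0) {T : Simplex d} (hT : MemM S.T0 T) (hb : T.bsv ∈ verticesOf 𝒯) :
    T.V ⊆ verticesOf 𝒯 := by
  rcases h𝒯.1.ancestor_or_V_subset hd hT with ⟨R, hR, hRT⟩ | h
  · exfalso
    obtain ⟨Q, hQ, hbQ⟩ := mem_verticesOf.mp hb
    obtain ⟨i, hi⟩ := h𝒯.2.mem_V hQ hR ((h𝒯.1.memM hQ).affineIndependent hd S.indep) hbQ
      (hRT.hull_subset T.bsv_mem_hull)
    have h1 := S.vgen_vertex_le (h𝒯.1.memM hR) i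
    rw [hi, S.vgen_bsv T hT] at h1
    have := hRT.gen_le
    omega
  · exact h

/-- The midpoint of an edge of a conforming triangulation is not a vertex of it. -/
lemma edgeMid_notMem (hd : 0 < d) (S : ColoredSetup d) {𝒯 : Finset (Simplex d)}
    (h𝒯 : 𝒯 ∈ Bisec S.T0) {e : Sym2 (Pt d)} (he : e ∈ edgesOf 𝒯) :
    edgeMid e ∉ verticesOf 𝒯 := by
  intro hb
  simp only [edgesOf, Set.mem_iUnion] at he
  obtain ⟨T, hT, i, j, hij, rfl⟩ := he
  obtain ⟨Q, hQ, hbQ⟩ := mem_verticesOf.mp hb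
  have hind := fun {T} (hT : T ∈ 𝒯) => (h𝒯.1.memM hT).affineIndependent hd S.indep
  have hm : midpoint ℝ (T.vertex i) (T.vertex j) ∈ T.V :=
    h𝒯.2.mem_V hQ hT (hind hQ) hbQ
      (T.hull_convex.midpoint_mem (T.vertex_mem_hull i) (T.vertex_mem_hull j))
  obtain ⟨l, hl⟩ := hm
  have hext := T.vertex_mem_extremePoints (hind hT) l
  have hne : T.vertex i ≠ T.vertex j := (hind hT).injective.ne hij
  have := hext.2 (T.vertex_mem_hull i) (T.vertex_mem_hull j)
    (hl ▸ midpoint_mem_openSegment (𝕜 := ℝ) _ _)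
  rw [hl, eq_comm, midpoint_eq_left_iff] at this
  exact hne this

/-! ### Descendants with a prescribed bisection edge -/

lemma Simplex.IsChild.k_eq {T T' : Simplex d} (h : T'.IsChild T) (hk : 2 ≤ T.k) :
    T'.k = T.k - 1 := by
  unfold Simplex.k at *
  rw [h.gen]
  have : (T.gen + 1) % d = T.gen % d + 1 := by
    rw [Nat.add_mod, Nat.mod_eq_of_lt (show 1 < d by omega), Nat.mod_eq_of_lt (by omega)]
  omega

lemma Simplex.IsChild.k_eq_of_one (hd : 0 < d) {T T' : Simplex d} (h : T'.IsChild T)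
    (hk : T.k = 1) : T'.k = d := by
  unfold Simplex.k at *
  rw [h.gen]
  have h1 : (T.gen + 1) % d = 0 := by
    have h2 := Nat.div_add_mod T.gen d
    have h3 : T.gen + 1 = d * (T.gen / d + 1) := by
      rw [mul_add]
      have := Nat.mod_lt T.gen hd
      omega
    rw [h3]
    simp
  omega

/-- `D` is a descendant in `MemM A` whose bisected path is the part of length `L` of the path
of `T` starting at position `a`. -/
def IsSubpath (A : Finset (Simplex d)) (T : Simplex d) (a L : ℕ) (D : Simplex d) : Prop :=
  MemM A D ∧ D.k = L ∧ D.gen + L = T.gen + T.k ∧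
    ∀ i j : Fin (d + 1), (i : ℕ) ≤ L → (j : ℕ) = a + i → D.vertex i = T.vertex j

lemma IsSubpath.child1 {A : Finset (Simplex d)} {T D : Simplex d} {a L : ℕ}
    (h : IsSubpath A T a (L + 1) D) (hL : 1 ≤ L) : IsSubpath A T a L D.child1 := by
  obtain ⟨h1, h2, h3, h4⟩ := h
  have hc : D.child1.IsChild D := Or.inl rfl
  refine ⟨h1.child hc, by rw [hc.k_eq (by omega)]; omega, by rw [hc.gen]; omega,
    fun i j hi hj => ?_⟩
  rw [D.child1_vertex_of_ne (by omega)]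
  exact h4 i j (by omega) hj

lemma IsSubpath.child2 {A : Finset (Simplex d)} {T D : Simplex d} {a L : ℕ}
    (h : IsSubpath A T a (L + 1) D) (hL : 1 ≤ L) : IsSubpath A T (a + 1) L D.child2 := by
  obtain ⟨h1, h2, h3, h4⟩ := h
  have hc : D.child2.IsChild D := Or.inr rfl
  refine ⟨h1.child hc, by rw [hc.k_eq (by omega)]; omega, by rw [hc.gen]; omega,
    fun i j hi hj => ?_⟩
  have := D.k_le
  rw [D.child2_vertex_lt (j := ⟨i + 1, by omega⟩) (by omega) rfl]
  exact h4 _ j (by simp; omega) (by simp; omega)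

lemma exists_isSubpath {A : Finset (Simplex d)} {T : Simplex d} (hT : MemM A T)
    {a L : ℕ} (hL : 1 ≤ L) (haL : a + L ≤ T.k) : ∃ D, IsSubpath A T a L D := by
  obtain ⟨m, hm⟩ : ∃ m, T.k = L + m := ⟨T.k - L, by omega⟩
  induction m generalizing a L with
  | zero =>
    refine ⟨T, hT, by omega, by omega, fun i j _ hj => ?_⟩
    rw [show i = j from Fin.ext (by omega)]
  | succ m ih =>
    rcases Nat.eq_zero_or_pos a with rfl | ha
    · obtain ⟨D, hD⟩ := ih (a := 0) (L := L + 1) (by omega) (by omega) (by omega)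
      exact ⟨_, hD.child1 hL⟩
    · obtain ⟨D, hD⟩ := ih (a := a - 1) (L := L + 1) (by omega) (by omega) (by omega)
      have := hD.child2 hL
      rw [Nat.sub_add_cancel ha] at this
      exact ⟨_, this⟩

lemma IsSubpath.bse {A : Finset (Simplex d)} {T D : Simplex d} {a L : ℕ}
    (h : IsSubpath A T a L D) {i j : Fin (d + 1)} (hi : (i : ℕ) = a) (hj : (j : ℕ) = a + L) :
    D.vertex 0 = T.vertex i ∧ D.vertex D.kIdx = T.vertex j := by
  obtain ⟨-, h2, -, h4⟩ := h
  exact ⟨h4 0 i (by simp) (by simpa using hi), h4 _ j (by simp [h2]) (by simp [h2, hj])⟩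

lemma IsSubpath.bsv {A : Finset (Simplex d)} {T D : Simplex d} {a L : ℕ}
    (h : IsSubpath A T a L D) {i j : Fin (d + 1)} (hi : (i : ℕ) = a) (hj : (j : ℕ) = a + L) :
    D.bsv = midpoint ℝ (T.vertex i) (T.vertex j) := by
  rw [Simplex.bsv, (h.bse hi hj).1, (h.bse hi hj).2]

/-- Every edge of a simplex of the master tree is the bisection edge of some descendant. -/
lemma exists_bse_eq (hd : 0 < d) {A : Finset (Simplex d)} {T : Simplex d} (hT : MemM A T)
    {i j : Fin (d + 1)} (hij : i < j) :
    ∃ D, MemM A D ∧ D.bse = s(T.vertex i, T.vertex j) := by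
  have hpath : ∀ {T : Simplex d}, MemM A T → ∀ {i j : Fin (d + 1)}, i < j → (j : ℕ) ≤ T.k →
      ∃ D, MemM A D ∧ D.bse = s(T.vertex i, T.vertex j) := by
    intro T hT i j hij hj
    have hij' : (i : ℕ) < j := hij
    obtain ⟨D, hD⟩ := exists_isSubpath hT (a := i) (L := j - i) (by omega) (by omega)
    have := hD.bse rfl (show (j : ℕ) = i + (j - i) by omega)
    exact ⟨D, hD.1, by rw [Simplex.bse, this.1, this.2]⟩
  obtain ⟨m, hm⟩ : ∃ m, T.k = m := ⟨_, rfl⟩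
  have hm1 := T.one_le_k hd
  induction m, (hm ▸ hm1 : 1 ≤ m) using Nat.le_induction generalizing T i j with
  | base =>
    rcases le_or_gt (j : ℕ) T.k with hj | hj
    · exact hpath hT hij hj
    · rcases eq_or_ne (i : ℕ) T.k with hi | hi
      · have hc : T.child2.IsChild T := Or.inr rfl
        have hk := hc.k_eq_of_one hd hm
        obtain ⟨D, hD, hDe⟩ := hpath (hT.child hc) (i := 0) (j := j)
          (show 0 < (j : ℕ) by omega) (by omega)
        refine ⟨D, hD, ?_⟩
        rw [hDe, T.child2_vertex_gt hj, T.child2_vertex_lt (j := i) (by simp; omega) (by simp; omega)]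
      · have hc : T.child1.IsChild T := Or.inl rfl
        have hk := hc.k_eq_of_one hd hm
        obtain ⟨D, hD, hDe⟩ := hpath (hT.child hc) hij (by omega)
        refine ⟨D, hD, ?_⟩
        rw [hDe, T.child1_vertex_of_ne hi, T.child1_vertex_of_ne hj.ne']
  | succ m hm' ih =>
    rcases le_or_gt (j : ℕ) T.k with hj | hj
    · exact hpath hT hij hj
    · have hij' : (i : ℕ) < j := hij
      rcases eq_or_ne (i : ℕ) T.k with hi | hi
      · have hc : T.child2.IsChild T := Or.inr rfl
        have hk := hc.k_eq (by omega)
        obtain ⟨D, hD, hDe⟩ := ih (hT.child hc) (i := ⟨i - 1, by omega⟩) (j := j)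
          (by rw [Fin.lt_def]; simp; omega) (by omega) (by omega)
        refine ⟨D, hD, ?_⟩
        rw [hDe, T.child2_vertex_gt hj, T.child2_vertex_lt (j := i) (by simp; omega) (by simp; omega)]
      · have hc : T.child1.IsChild T := Or.inl rfl
        have hk := hc.k_eq (by omega)
        obtain ⟨D, hD, hDe⟩ := ih (hT.child hc) hij (by omega) (by omega)
        refine ⟨D, hD, ?_⟩
        rw [hDe, T.child1_vertex_of_ne hi, T.child1_vertex_of_ne hj.ne']

/-- If the midpoint of a subpath of a simplex is a vertex of a conforming triangulation,
then so are the midpoints of all larger subpaths. -/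
lemma midpoint_mem_of_le (hd : 0 < d) (S : ColoredSetup d) {𝒯 : Finset (Simplex d)}
    (h𝒯 : 𝒯 ∈ Bisec S.T0) {T : Simplex d} (hT : MemM S.T0 T) (hk : T.k = d)
    {a b a' b' : Fin (d + 1)} (hab : a < b) (ha : a' ≤ a) (hb : b ≤ b')
    (hm : midpoint ℝ (T.vertex a) (T.vertex b) ∈ verticesOf 𝒯) :
    midpoint ℝ (T.vertex a') (T.vertex b') ∈ verticesOf 𝒯 := by
  rw [Fin.lt_def] at hab
  rw [Fin.le_def] at ha hb
  have extend : ∀ {D D' : Simplex d}, MemM S.T0 D → D'.IsChild D → D'.bsv ∈ verticesOf 𝒯 →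
      D.bsv ∈ verticesOf 𝒯 := fun hD hc hb =>
    V_subset_of_bsv_mem hd S h𝒯 (hD.child hc) hb (Simplex.bsv_mem_V_of_isChild hc)
  obtain ⟨m, hm'⟩ : ∃ m, (a - a' : ℕ) + (b' - b) = m := ⟨_, rfl⟩
  induction m generalizing a b with
  | zero =>
    rwa [show a' = a from Fin.ext (by omega), show b' = b from Fin.ext (by omega)]
  | succ m ih =>
    rcases ha.lt_or_eq with ha' | ha'
    · obtain ⟨D, hD⟩ := exists_isSubpath hT (a := a - 1) (L := b - a + 1) (by omega) (by omega)
      have hD' := hD.child2 (by omega)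
      rw [Nat.sub_add_cancel (by omega)] at hD'
      have := extend hD.1 (Or.inr rfl) (by rwa [hD'.bsv (i := a) (j := b) rfl (by omega)])
      rw [hD.bsv (i := ⟨a - 1, by omega⟩) (j := b) rfl (by omega)] at this
      exact ih (by simp; omega) (by simp; omega) hb this (by simp; omega)
    · obtain ⟨D, hD⟩ := exists_isSubpath hT (a := a) (L := b - a + 1) (by omega) (by omega)
      have hD' := hD.child1 (by omega)
      have := extend hD.1 (Or.inl rfl) (by rwa [hD'.bsv (i := a) (j := b) rfl (by omega)])
      rw [hD.bsv (i := a) (j := ⟨b + 1, by omega⟩) rfl (by simp; omega)] at this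
      exact ih (by simp; omega) (by omega) (by simp; omega) this (by simp; omega)

lemma V_subset_of_midpoint_mem (hd : 0 < d) (S : ColoredSetup d) {𝒯 : Finset (Simplex d)}
    (h𝒯 : 𝒯 ∈ Bisec S.T0) {T : Simplex d} (hT : MemM S.T0 T) (hk : T.k = d)
    {a b : Fin (d + 1)} (hab : a < b)
    (hm : midpoint ℝ (T.vertex a) (T.vertex b) ∈ verticesOf 𝒯) : T.V ⊆ verticesOf 𝒯 := by
  refine V_subset_of_bsv_mem hd S h𝒯 hT ?_
  refine midpoint_mem_of_le hd S h𝒯 hT hk hab (Fin.zero_le _) ?_ hm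
  rw [Fin.le_def, Simplex.kIdx_val]
  omega

/-! ### Coordinates of the simplices in the master tree of a Kuhn simplex -/

/-- Coordinate description of a simplex of generation `(M + 1) * d - k`: its first `k + 1` vertices
form a lattice path with step size `2⁻ᴹ`, and the remaining ones are centers of cubes. -/
structure HasForm (T : Simplex d) (M k : ℕ) (c ε : Fin d → ℤ) (τ : Fin d → ℕ) : Prop where
  k_le : k ≤ d
  gen : T.gen + k = (M + 1) * d
  sign : ∀ x, ε x = 1 ∨ ε x = -1
  inj : Function.Injective τ
  lt : ∀ x, τ x < d
  vertex : ∀ (i : Fin (d + 1)) (x : Fin d), T.vertex i x =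
    (1 / 2 : ℝ) ^ M *
      (c x + (if (i : ℕ) ≤ k then 1 else 1 / 2) * (if τ x < (i : ℕ) then (ε x : ℝ) else 0))

namespace HasForm

variable {T : Simplex d} {M k : ℕ} {c ε : Fin d → ℤ} {τ : Fin d → ℕ}

lemma k_eq (h : HasForm T M k c ε τ) (hk : 1 ≤ k) : T.k = k := by
  have h1 := h.gen
  have h2 := h.k_le
  have h3 : T.gen = M * d + (d - k) := by
    rw [add_mul, one_mul] at h1
    omega
  unfold Simplex.k
  rw [h3, Nat.mul_add_mod_self_right, Nat.mod_eq_of_lt (by omega)]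
  omega

lemma bsv (h : HasForm T M k c ε τ) (hk : 1 ≤ k) (x : Fin d) :
    T.bsv x = (1 / 2 : ℝ) ^ M * (c x + 1 / 2 * (if τ x < k then (ε x : ℝ) else 0)) := by
  simp [Simplex.bsv, midpoint_eq_smul_add, h.vertex, h.k_eq hk]
  split_ifs <;> ring

lemma child1 (h : HasForm T M k c ε τ) (hk : 1 ≤ k) : HasForm T.child1 M (k - 1) c ε τ where
  k_le := by have := h.k_le; omega
  gen := by rw [← h.gen, Simplex.child1_gen]; omega
  sign := h.sign
  inj := h.inj
  lt := h.lt
  vertex i x := by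
    have hkT := h.k_eq hk
    rcases eq_or_ne (i : ℕ) k with hi | hi
    · rw [show i = T.kIdx from Fin.ext (by simp; omega), T.child1_vertex_k, h.bsv hk]
      simp [hkT, show ¬ (k ≤ k - 1) by omega]
    · rw [T.child1_vertex_of_ne (by omega), h.vertex]
      simp only [show (i : ℕ) ≤ k ↔ (i : ℕ) ≤ k - 1 by omega]

lemma child2 (h : HasForm T M k c ε τ) (hk : 1 ≤ k) :
    HasForm T.child2 M (k - 1) (fun x => if τ x = 0 then c x + ε x else c x)
      (fun x => if τ x = 0 then -ε x else ε x)
      (fun x => if τ x = 0 then k - 1 else if τ x < k then τ x - 1 else τ x) where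
  k_le := by have := h.k_le; omega
  gen := by rw [← h.gen, Simplex.child2_gen]; omega
  sign x := by
    have := h.sign x
    split_ifs <;> omega
  inj x y hxy := by
    apply h.inj
    dsimp only at hxy
    split_ifs at hxy <;> omega
  lt x := by
    have := h.lt x
    have := h.k_le
    split_ifs <;> omega
  vertex i x := by
    have hkT := h.k_eq hk
    have hkd := h.k_le
    rcases lt_trichotomy (i : ℕ) k with hi | hi | hi
    · rw [T.child2_vertex_lt (j := ⟨i + 1, by omega⟩) (by omega) rfl, h.vertex]
      simp only [show (i : ℕ) + 1 ≤ k by omega, show (i : ℕ) ≤ k - 1 by omega, if_true]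
      congr 1
      by_cases h0 : τ x = 0
      · simp [h0, show ¬ (k - 1 < (i : ℕ)) by omega]
      · by_cases h1 : τ x < k
        · simp [h0, h1, show τ x < (i : ℕ) + 1 ↔ τ x - 1 < (i : ℕ) by omega]
        · simp [h0, h1, show ¬ τ x < (i : ℕ) + 1 by omega, show ¬ τ x < (i : ℕ) by omega]
    · rw [show i = T.kIdx from Fin.ext (by simp; omega), T.child2_vertex_k, h.bsv hk]
      simp only [Simplex.kIdx_val, hkT, show ¬ (k ≤ k - 1) by omega, if_false]
      congr 1
      by_cases h0 : τ x = 0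
      · simp [h0, show 0 < k by omega]
        ring
      · by_cases h1 : τ x < k
        · simp [h0, h1, show τ x - 1 < k by omega]
        · simp [h0, h1]
    · rw [T.child2_vertex_gt (by omega), h.vertex]
      simp only [show ¬ (i : ℕ) ≤ k by omega, show ¬ (i : ℕ) ≤ k - 1 by omega, if_false]
      congr 1
      by_cases h0 : τ x = 0
      · simp [h0, show k - 1 < (i : ℕ) by omega, show 0 < (i : ℕ) by omega]
        ring
      · by_cases h1 : τ x < k
        · simp [h0, h1, show τ x - 1 < (i : ℕ) by omega, show τ x < (i : ℕ) by omega]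
        · simp [h0, h1]

lemma succ_level (h : HasForm T M 0 c ε τ) :
    HasForm T (M + 1) d (fun x => 2 * c x) ε τ where
  k_le := le_rfl
  gen := by have := h.gen; rw [add_mul _ _ d]; omega
  sign := h.sign
  inj := h.inj
  lt := h.lt
  vertex i x := by
    rw [h.vertex]
    have hi : (i : ℕ) ≤ d := by omega
    rcases Nat.eq_zero_or_pos (i : ℕ) with h0 | h0
    · simp [h0, pow_succ]
      ring
    · simp [h0.ne', hi, pow_succ]
      split_ifs <;> ring

lemma card_filter_lt (h : HasForm T M k c ε τ) :
    (Finset.univ.filter fun x => τ x < k).card = k := by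
  have hinj : Function.Injective fun x => (⟨τ x, h.lt x⟩ : Fin d) := fun x y hxy =>
    h.inj (by simpa using hxy)
  have hbij := Finite.injective_iff_bijective.mp hinj
  have hk := h.k_le
  calc (Finset.univ.filter fun x => τ x < k).card
      = (Finset.univ.filter fun y : Fin d => (y : ℕ) < k).card := by
        refine Finset.card_bijective _ hbij fun x => ?_
        simp
    _ = k := by
        rw [Fin.card_filter_val_lt]
        omega

end HasForm

lemma exists_hasForm (hd : 0 < d) {π : Equiv.Perm (Fin d)} {T : Simplex d}
    (hT : MemM {kuhnSimplex d π} T) : ∃ M k c ε τ, HasForm T M k c ε τ ∧ 1 ≤ k ∧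
      (k = d → ∀ x, Even (c x)) := by
  induction hT with
  | init h =>
    rw [Finset.mem_singleton] at h
    subst h
    refine ⟨0, d, fun _ => 0, fun _ => 1, fun x => π.symm x,
      ⟨le_rfl, by simp [kuhnSimplex], by simp, fun x y h => ?_, fun x => (π.symm x).2,
        fun i x => ?_⟩, hd, by simp⟩
    · exact π.symm.injective (Fin.ext h)
    · have : (i : ℕ) ≤ d := by omega
      simp [kuhnSimplex, this]
  | @child T T' hT hc ih =>
    obtain ⟨M, k, c, ε, τ, h, hk, -⟩ := ih
    obtain ⟨c', ε', τ', h'⟩ : ∃ c' ε' τ', HasForm T' M (k - 1) c' ε' τ' := by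
      rcases hc with rfl | rfl
      · exact ⟨_, _, _, h.child1 hk⟩
      · exact ⟨_, _, _, h.child2 hk⟩
    rcases eq_or_ne k 1 with rfl | hk1
    · exact ⟨M + 1, d, _, _, _, h'.succ_level, hd, by simp⟩
    · have := h.k_le
      exact ⟨M, k - 1, c', ε', τ', h', by omega, by omega⟩

/-- Coordinates of the points in a simplex whose vertices form a full lattice path. -/
lemma HasForm.exists_antitone {T : Simplex d} {M : ℕ} {c ε : Fin d → ℤ} {τ : Fin d → ℕ}
    (h : HasForm T M d c ε τ) {p : Pt d} (hp : p ∈ T.hull) :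
    ∃ Y : ℕ → ℝ, Antitone Y ∧ (∀ n, 0 ≤ Y n) ∧ (∀ n, Y n ≤ 1) ∧
      ∀ x, p x = (1 / 2 : ℝ) ^ M * (c x + ε x * Y (τ x)) := by
  refine convexHull_min (t := {p | ∃ Y : ℕ → ℝ, Antitone Y ∧ (∀ n, 0 ≤ Y n) ∧ (∀ n, Y n ≤ 1) ∧
      ∀ x, p x = (1 / 2 : ℝ) ^ M * (c x + ε x * Y (τ x))}) ?_ ?_ hp
  · rintro _ ⟨i, rfl⟩
    refine ⟨fun n => if n < (i : ℕ) then 1 else 0, fun m n hmn => ?_, fun n => ?_, fun n => ?_,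
      fun x => ?_⟩
    · dsimp only
      split_ifs <;> first | omega | norm_num
    · dsimp only
      split_ifs <;> norm_num
    · dsimp only
      split_ifs <;> norm_num
    · rw [h.vertex, if_pos (by omega : (i : ℕ) ≤ d)]
      simp
  · rintro p ⟨Y, hY, hY0, hY1, hp⟩ q ⟨Z, hZ, hZ0, hZ1, hq⟩ a b ha hb hab
    refine ⟨fun n => a * Y n + b * Z n, fun m n hmn => ?_, fun n => ?_, fun n => ?_, fun x => ?_⟩
    · have := mul_le_mul_of_nonneg_left (hY hmn) ha
      have := mul_le_mul_of_nonneg_left (hZ hmn) hb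
      dsimp only
      linarith
    · have := mul_nonneg ha (hY0 n)
      have := mul_nonneg hb (hZ0 n)
      dsimp only
      linarith
    · have := mul_le_mul_of_nonneg_left (hY1 n) ha
      have := mul_le_mul_of_nonneg_left (hZ1 n) hb
      dsimp only
      linarith
    · simp only [Pi.add_apply, Pi.smul_apply, smul_eq_mul, hp, hq]
      have hb' : b = 1 - a := by linarith
      subst hb'
      ring

lemma exists_threshold {Y : ℕ → ℝ} (hY : Antitone Y) (t : ℝ) :
    ∃ i : Fin (d + 1), ∀ n < d, n < (i : ℕ) ↔ t < Y n := by
  classical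
  have hex : ∃ n, n = d ∨ Y n ≤ t := ⟨d, Or.inl rfl⟩
  refine ⟨⟨Nat.find hex, Nat.lt_succ_of_le (Nat.find_le (Or.inl rfl))⟩, fun n hn => ?_⟩
  simp only [Nat.lt_find_iff]
  constructor
  · intro h
    have := h n le_rfl
    push Not at this
    exact this.2
  · intro h m hm
    push Not
    exact ⟨by omega, h.trans_le (hY hm)⟩

/-! ### Directions at a lattice point -/

/-- The sign pattern of the entries of `r` of absolute value larger than `j`. -/
def pat (j : ℕ) (r : Fin d → ℤ) (x : Fin d) : ℤ := if (j : ℤ) < |r x| then (r x).sign else 0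

/-- The direction `r` points from `v` into the set `Ω`. -/
def Feasible (Ω : Set (Pt d)) (v : Pt d) (r : Fin d → ℤ) : Prop :=
  ∃ δ : ℝ, 0 < δ ∧ v + δ • (fun x => (r x : ℝ)) ∈ Ω

lemma Feasible.of_le {Ω : Set (Pt d)} (hΩ : Convex ℝ Ω) {v : Pt d} (hv : v ∈ Ω) {r : Fin d → ℤ}
    (h : Feasible Ω v r) : ∃ δ₀ : ℝ, 0 < δ₀ ∧ ∀ δ, 0 ≤ δ → δ ≤ δ₀ →
      v + δ • (fun x => (r x : ℝ)) ∈ Ω := by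
  obtain ⟨δ₀, h0, hm⟩ := h
  refine ⟨δ₀, h0, fun δ hδ hδ₀ => ?_⟩
  have := hΩ.add_smul_mem hv hm (t := δ / δ₀) ⟨by positivity, (div_le_one h0).mpr hδ₀⟩
  rwa [smul_smul, div_mul_cancel₀ _ h0.ne'] at this

lemma Feasible.add {Ω : Set (Pt d)} (hΩ : Convex ℝ Ω) {v : Pt d} (hv : v ∈ Ω)
    {r r' : Fin d → ℤ} (h : Feasible Ω v r) (h' : Feasible Ω v r') : Feasible Ω v (r + r') := by
  obtain ⟨δ, hδ, hm⟩ := h.of_le hΩ hv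
  obtain ⟨δ', hδ', hm'⟩ := h'.of_le hΩ hv
  have h0 : 0 < min δ δ' := lt_min hδ hδ'
  refine ⟨min δ δ' / 2, by positivity, ?_⟩
  convert hΩ.midpoint_mem (hm _ h0.le (min_le_left _ _)) (hm' _ h0.le (min_le_right _ _)) using 1
  ext x
  simp [midpoint_eq_smul_add]
  ring

lemma Feasible.nsmul {Ω : Set (Pt d)} {v : Pt d} {r : Fin d → ℤ} (h : Feasible Ω v r) {n : ℕ}
    (hn : 0 < n) : Feasible Ω v (fun x => n * r x) := by
  obtain ⟨δ, hδ, hm⟩ := h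
  refine ⟨δ / n, by positivity, ?_⟩
  convert hm using 2
  ext x
  simp
  field_simp

lemma star_coord_pos {n c r : ℤ} {η Y : ℝ} {j : ℕ} (hc : Even c) (hη : 0 < η)
    (hr : |η * r| < 1 / 2) (hj : η * (j + 1 / 2) < 1 / 2) (hY0 : 0 ≤ Y) (hY1 : Y ≤ 1)
    (hq : n + η * r = c + Y) :
    (c + (if η * (j + 1 / 2) < Y then 1 else 0) =
      n + if Even n then (if (j : ℤ) < |r| then r.sign else 0) else 0) ∧
    (c + (if 1 - η * (j + 1 / 2) < Y then 1 else 0) =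
      n + if Even n then 0 else (if (j : ℤ) < |r| then r.sign else 0)) := by
  rw [abs_lt] at hr
  have h1 : n < c + 2 := by
    have : (n : ℝ) < c + 2 := by linarith
    exact_mod_cast this
  have h2 : c - 1 < n := by
    have : (c : ℝ) - 1 < n := by linarith
    exact_mod_cast this
  have key (m : ℤ) : η * (j + 1 / 2) < η * m ↔ (j : ℤ) < m := by
    rw [mul_lt_mul_iff_right₀ hη]
    constructor
    · intro h
      have : (j : ℝ) < m := by linarith
      exact_mod_cast this
    · intro h
      have : (j : ℝ) + 1 ≤ m := by exact_mod_cast h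
      linarith
  rcases (by omega : n = c ∨ n = c + 1) with rfl | rfl
  · have hY : Y = η * r := by linarith
    have hr0 : 0 ≤ r := by
      have : (0 : ℝ) ≤ r := nonneg_of_mul_nonneg_right (hY ▸ hY0) hη
      exact_mod_cast this
    rw [if_pos hc, if_pos hc, if_neg (show ¬ 1 - η * (j + 1 / 2) < Y by linarith),
      abs_of_nonneg hr0]
    refine ⟨?_, by ring⟩
    rw [hY]
    simp only [key]
    split_ifs with h
    · rw [Int.sign_eq_one_of_pos (by omega)]
    · rfl
  · have hY : Y = 1 + η * r := by push_cast at hq; linarith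
    have hr0 : r ≤ 0 := by
      have : (0 : ℝ) ≤ -r := nonneg_of_mul_nonneg_right (a := η) (by linarith) hη
      have : (r : ℝ) ≤ 0 := by linarith
      exact_mod_cast this
    have hne : ¬ Even (c + 1) := by
      rw [Int.not_even_iff_odd]
      exact hc.add_one
    rw [if_neg hne, if_neg hne, if_pos (show η * (j + 1 / 2) < Y by linarith),
      abs_of_nonpos hr0]
    refine ⟨by ring, ?_⟩
    have hiff : 1 - η * (j + 1 / 2) < Y ↔ ¬ (j : ℤ) < -r := by
      rw [hY, not_lt]
      have hk : η * (j + 1 / 2) ≠ η * ((-r : ℤ) : ℝ) := by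
        intro h
        have h := mul_left_cancel₀ hη.ne' h
        have h : ((2 * j + 1 : ℤ) : ℝ) = ((2 * (-r) : ℤ) : ℝ) := by
          push_cast at h ⊢
          linarith
        have h : (2 * j + 1 : ℤ) = 2 * (-r) := by exact_mod_cast h
        omega
      rw [← not_iff_not, not_le, ← key]
      push_cast at hk ⊢
      constructor
      · intro h
        exact lt_of_le_of_ne (by linarith) hk
      · intro h
        linarith
    simp only [hiff]
    split_ifs with h
    · rw [Int.sign_eq_neg_one_of_neg (by omega)]
      ring
    · ring

lemma star_coord {n c ε r : ℤ} {η Y : ℝ} {j : ℕ} (hc : Even c) (hε : ε = 1 ∨ ε = -1)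
    (hη : 0 < η) (hr : |η * r| < 1 / 2) (hj : η * (j + 1 / 2) < 1 / 2) (hY0 : 0 ≤ Y)
    (hY1 : Y ≤ 1) (hq : n + η * r = c + ε * Y) :
    (c + (if η * (j + 1 / 2) < Y then ε else 0) =
      n + if Even n then (if (j : ℤ) < |r| then r.sign else 0) else 0) ∧
    (c + (if 1 - η * (j + 1 / 2) < Y then ε else 0) =
      n + if Even n then 0 else (if (j : ℤ) < |r| then r.sign else 0)) := by
  rcases hε with rfl | rfl
  · exact star_coord_pos hc hη hr hj hY0 hY1 (by simpa using hq)
  · have := star_coord_pos (n := -n) (c := -c) (r := -r) hc.neg hη (by simpa using hr) hj hY0 hY1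
      (by push_cast at hq ⊢; linarith)
    simp only [even_neg, abs_neg, Int.sign_neg] at this
    obtain ⟨h1, h2⟩ := this
    constructor
    · split_ifs at h1 ⊢ <;> linarith
    · split_ifs at h2 ⊢ <;> linarith

/-- Near a lattice point `v` of level `M` in the root simplex, every feasible direction `r` is
realized by a simplex of the uniform refinement, on whose path one finds cubes with corner `v`
whose directions are the sign patterns of `r`. -/
lemma exists_star (hd : 0 < d) {π : Equiv.Perm (Fin d)} (M N : ℕ) {v : Pt d} {n : Fin d → ℤ}
    (hv : ∀ x, v x = (1 / 2 : ℝ) ^ M * n x) (hvm : v ∈ (kuhnSimplex d π).hull) {r : Fin d → ℤ}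
    (hr : Feasible (kuhnSimplex d π).hull v r) :
    ∃ T, MemM {kuhnSimplex d π} T ∧ T.k = d ∧ ∃ a b : ℕ → Fin (d + 1),
      (∀ j ≤ N, ∀ x, T.vertex (a j) x =
        (1 / 2 : ℝ) ^ M * (n x + if Even (n x) then 0 else (pat j r x : ℝ))) ∧
      (∀ j ≤ N, ∀ x, T.vertex (b j) x =
        (1 / 2 : ℝ) ^ M * (n x + if Even (n x) then (pat j r x : ℝ) else 0)) ∧
      (∀ j ≤ N, a j ≤ b j) ∧ ∀ i j, i ≤ j → j ≤ N → a i ≤ a j ∧ b j ≤ b i := by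
  set H : ℝ := (1 / 2 : ℝ) ^ M with hH
  have hH0 : 0 < H := by positivity
  obtain ⟨R, hR⟩ : ∃ R : ℤ, ∀ x, |r x| ≤ R := by
    obtain ⟨R, hR⟩ := (Set.finite_range fun x => |r x|).bddAbove
    exact ⟨R, fun x => hR ⟨x, rfl⟩⟩
  obtain ⟨δ₀, hδ₀, hfeas⟩ := hr.of_le (Simplex.hull_convex _) hvm
  have hB : (0 : ℝ) < 2 * (|R| + N + 1) := by positivity
  -- `η` is the step size relative to the lattice spacing `H`
  obtain ⟨η, hη, hηδ, hηB⟩ : ∃ η : ℝ, 0 < η ∧ H * η ≤ δ₀ ∧ η * (2 * (|R| + N + 1)) ≤ 1 := by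
    refine ⟨min (δ₀ / H) (1 / (2 * (|R| + N + 1))), by positivity, ?_, ?_⟩
    · calc H * _ ≤ H * (δ₀ / H) := mul_le_mul_of_nonneg_left (min_le_left _ _) hH0.le
        _ = δ₀ := by field_simp
    · calc _ ≤ 1 / (2 * (|R| + N + 1)) * (2 * (|R| + N + 1) : ℝ) :=
            mul_le_mul_of_nonneg_right (min_le_right _ _) hB.le
        _ = 1 := by field_simp
  obtain ⟨T, hT, hTg, hpT⟩ := exists_descendant hd (hfeas (H * η) (by positivity) hηδ)
    (g := M * d) (by simp [kuhnSimplex])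
  have hTk : T.k = d := by simp [Simplex.k, hTg]
  obtain ⟨M', k, c, ε, τ, hF, hk, hc⟩ := exists_hasForm hd hT
  obtain rfl : k = d := (hF.k_eq hk).symm.trans hTk
  obtain rfl : M' = M := by
    have := hF.gen
    rw [hTg, add_mul, one_mul] at this
    exact (Nat.eq_of_mul_eq_mul_right hd (by omega)).symm
  obtain ⟨Y, hY, hY0, hY1, hp⟩ := hF.exists_antitone hpT
  have hc := hc rfl
  have hq : ∀ x, (n x : ℝ) + η * r x = c x + ε x * Y (τ x) := by
    intro x
    have := hp x
    simp only [Pi.add_apply, Pi.smul_apply, smul_eq_mul, hv] at this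
    refine mul_left_cancel₀ hH0.ne' ?_
    linarith
  choose b hb using fun j : ℕ => exists_threshold (d := k) hY (η * (j + 1 / 2))
  choose a ha using fun j : ℕ => exists_threshold (d := k) hY (1 - η * (j + 1 / 2))
  have hηj : ∀ j ≤ N, η * (j + 1 / 2) < 1 / 2 := by
    intro j hj
    have hjN : (j : ℝ) ≤ N := by exact_mod_cast hj
    have hR0 : (0 : ℝ) ≤ |R| := by positivity
    have : η * (j + 1 / 2) < η * (|R| + N + 1) := mul_lt_mul_of_pos_left (by linarith) hη
    linarith
  have hηr : ∀ x, |η * r x| < 1 / 2 := by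
    intro x
    have h1 : |(r x : ℝ)| ≤ |(R : ℝ)| := by exact_mod_cast (hR x).trans (le_abs_self R)
    have h2 : η * |(r x : ℝ)| < η * (|R| + N + 1) :=
      mul_lt_mul_of_pos_left (by have : (0 : ℝ) ≤ N := by positivity
                                 push_cast
                                 linarith) hη
    rw [abs_mul, abs_of_pos hη]
    push_cast at *
    linarith
  have hle {i i' : Fin (k + 1)} (h : ∀ m < k, m < (i : ℕ) → m < (i' : ℕ)) : i ≤ i' := by
    by_contra! hlt
    have := h i' (by have := Fin.lt_def.mp hlt; omega) hlt
    omega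
  refine ⟨T, hT, hTk, a, b, fun j hj x => ?_, fun j hj x => ?_, fun j hj => ?_,
    fun i j hij hj => ⟨?_, ?_⟩⟩
  · have := (star_coord (hc x) (hF.sign x) hη (hηr x) (hηj j hj) (hY0 _) (hY1 _) (hq x)).2
    rw [hF.vertex, if_pos (by omega), one_mul]
    simp only [ha j _ (hF.lt x)]
    congr 1
    exact_mod_cast this
  · have := (star_coord (hc x) (hF.sign x) hη (hηr x) (hηj j hj) (hY0 _) (hY1 _) (hq x)).1
    rw [hF.vertex, if_pos (by omega), one_mul]
    simp only [hb j _ (hF.lt x)]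
    congr 1
    exact_mod_cast this
  · refine hle fun m hm => ?_
    rw [ha j m hm, hb j m hm]
    have := hηj j hj
    intro h
    linarith
  · refine hle fun m hm => ?_
    rw [ha i m hm, ha j m hm]
    have : η * ((i : ℝ) + 1 / 2) ≤ η * (j + 1 / 2) := by gcongr
    intro h
    linarith
  · refine hle fun m hm => ?_
    rw [hb i m hm, hb j m hm]
    have : η * ((i : ℝ) + 1 / 2) ≤ η * (j + 1 / 2) := by gcongr
    intro h
    linarith

/-- The point reached from `v` in direction `s` with step size `2⁻ᵐ`. -/
def stepPt (v : Pt d) (m : ℕ) (s : Fin d → ℤ) : Pt d := fun x => v x + (1 / 2 : ℝ) ^ m * s x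

/-- `v` has coordinates in `2⁻ᴹ ℤ`. -/
def IsLattice (M : ℕ) (v : Pt d) : Prop := ∃ n : Fin d → ℤ, ∀ x, v x = (1 / 2 : ℝ) ^ M * n x

lemma IsLattice.even {M : ℕ} {v : Pt d} (h : IsLattice M v) :
    ∃ n : Fin d → ℤ, (∀ x, v x = (1 / 2 : ℝ) ^ (M + 1) * n x) ∧ ∀ x, Even (n x) := by
  obtain ⟨n, hn⟩ := h
  refine ⟨fun x => 2 * n x, fun x => ?_, fun x => even_two_mul _⟩
  rw [hn, pow_succ]
  push_cast
  ring

lemma IsLattice.add {M : ℕ} {v : Pt d} (h : IsLattice M v) (t : ℕ) : IsLattice (M + t) v := by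
  induction t with
  | zero => exact h
  | succ t ih =>
    obtain ⟨n, hn, -⟩ := ih.even
    exact ⟨n, hn⟩

/-- Closure properties of the vertex set `W` of a conforming refinement of a domain `Ω` in the
directions at a lattice point. -/
structure StarClosed (Ω W : Set (Pt d)) : Prop where
  convex : Convex ℝ Ω
  feasible_pat : ∀ {M : ℕ} {v : Pt d} {r : Fin d → ℤ} (j : ℕ), IsLattice M v → v ∈ Ω →
    Feasible Ω v r → Feasible Ω v (pat j r)
  step_mono : ∀ {M : ℕ} {v : Pt d} {r : Fin d → ℤ} {i j : ℕ}, IsLattice M v → v ∈ Ω →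
    Feasible Ω v r → i ≤ j → pat j r ≠ 0 → stepPt v (M + 1) (pat j r) ∈ W →
    stepPt v (M + 1) (pat i r) ∈ W
  step_double : ∀ {M : ℕ} {v : Pt d} {r : Fin d → ℤ} (i : ℕ) {j : ℕ}, IsLattice M v → v ∈ Ω →
    Feasible Ω v r → pat j r ≠ 0 → stepPt v (M + 2) (pat j r) ∈ W →
    stepPt v (M + 1) (pat i r) ∈ W

lemma starClosed (hd : 0 < d) {π : Equiv.Perm (Fin d)} (S : ColoredSetup d)
    (hS : S.T0 = {kuhnSimplex d π}) {𝒯 : Finset (Simplex d)} (h𝒯 : 𝒯 ∈ Bisec S.T0) :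
    StarClosed (kuhnSimplex d π).hull (verticesOf 𝒯) := by
  have main : ∀ {M : ℕ} {v : Pt d} {n : Fin d → ℤ} {r : Fin d → ℤ} {i j : ℕ},
      (∀ x, v x = (1 / 2 : ℝ) ^ M * n x) → v ∈ (kuhnSimplex d π).hull →
      Feasible (kuhnSimplex d π).hull v r → pat j r ≠ 0 → stepPt v (M + 1) (pat j r) ∈ verticesOf 𝒯 →
      (i ≤ j → stepPt v (M + 1) (pat i r) ∈ verticesOf 𝒯) ∧
      ((∀ x, Even (n x)) → stepPt v M (pat i r) ∈ verticesOf 𝒯) := by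
    intro M v n r i j hn hv hr hne hj
    obtain ⟨T, hT, hTk, a, b, ha, hb, hab, hmono⟩ := exists_star hd M (max i j) hn hv hr
    rw [← hS] at hT
    have hmid : ∀ l ≤ max i j,
        midpoint ℝ (T.vertex (a l)) (T.vertex (b l)) = stepPt v (M + 1) (pat l r) := by
      intro l hl
      ext x
      simp only [stepPt, midpoint_eq_smul_add, Pi.smul_apply, Pi.add_apply, smul_eq_mul,
        ha l hl, hb l hl, hn, pow_succ]
      rw [show (⅟2 : ℝ) = 1 / 2 by norm_num]
      split_ifs <;> ring
    have hlt : a j < b j := by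
      refine lt_of_le_of_ne (hab j (le_max_right _ _)) fun h => hne ?_
      ext x
      have h1 := ha j (le_max_right _ _) x
      rw [h, hb j (le_max_right _ _)] at h1
      have h2 := mul_left_cancel₀ (by positivity) h1
      split_ifs at h2
      · have h3 : (pat j r x : ℝ) = 0 := by linarith
        exact_mod_cast h3
      · have h3 : (pat j r x : ℝ) = 0 := by linarith
        exact_mod_cast h3
    rw [← hmid j (le_max_right _ _)] at hj
    refine ⟨fun hij => ?_, fun he => ?_⟩
    · rw [← hmid i (le_max_left _ _)]
      obtain ⟨h1, h2⟩ := hmono i j hij (le_max_right _ _)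
      exact midpoint_mem_of_le hd S h𝒯 hT hTk hlt h1 h2 hj
    · have : stepPt v M (pat i r) = T.vertex (b i) := by
        ext x
        rw [hb i (le_max_left _ _), if_pos (he x), stepPt, hn]
        ring
      rw [this]
      exact V_subset_of_midpoint_mem hd S h𝒯 hT hTk hlt hj ⟨_, rfl⟩
  refine ⟨Simplex.hull_convex _, ?_, ?_, ?_⟩
  · intro M v r j hv hvm hr
    obtain ⟨n, hn, he⟩ := hv.even
    obtain ⟨T, hT, -, a, b, -, hb, -⟩ := exists_star hd (M + 1) j hn hvm hr
    refine ⟨(1 / 2 : ℝ) ^ (M + 1), by positivity, ?_⟩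
    have : v + (1 / 2 : ℝ) ^ (M + 1) • (fun x => (pat j r x : ℝ)) = T.vertex (b j) := by
      ext x
      simp only [Pi.add_apply, Pi.smul_apply, smul_eq_mul]
      rw [hb j le_rfl, if_pos (he x), hn]
      ring
    rw [this]
    exact hT.hull_subset (T.vertex_mem_hull _)
  · rintro M v r i j ⟨n, hn⟩ hvm hr hij hne hj
    exact (main hn hvm hr hne hj).1 hij
  · rintro M v r i j hv hvm hr hne hj
    obtain ⟨n, hn, he⟩ := hv.even
    exact (main hn hvm hr hne hj).2 he

/-- All entries are `-1`, `0` or `1`. -/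
def IsSignVec (s : Fin d → ℤ) : Prop := ∀ x, s x = -1 ∨ s x = 0 ∨ s x = 1

/-- `s` is not opposite to `s'` on the whole support of `s'`. -/
def Linked (s s' : Fin d → ℤ) : Prop := ∃ x, s' x ≠ 0 ∧ s x ≠ -s' x

lemma isSignVec_pat (j : ℕ) (r : Fin d → ℤ) : IsSignVec (pat j r) := by
  intro x
  unfold pat
  split_ifs
  · rcases Int.sign_trichotomy (r x) with h | h | h <;> omega
  · simp

lemma Linked.self {s : Fin d → ℤ} (hs : s ≠ 0) : Linked s s := by
  obtain ⟨x, hx⟩ := Function.ne_iff.mp hs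
  exact ⟨x, hx, fun h => hx (by simp only [Pi.zero_apply]; omega)⟩

section StarClosed

variable {Ω W : Set (Pt d)} {v : Pt d} {s s' : Fin d → ℤ}

lemma StarClosed.step_of_linked (h : StarClosed Ω W) {M : ℕ} (hv : IsLattice M v) (hvm : v ∈ Ω)
    (hs : IsSignVec s) (hs' : IsSignVec s') (hs0 : s ≠ 0) (hf : Feasible Ω v s)
    (hf' : Feasible Ω v s') (hl : Linked s s') (hw : stepPt v (M + 2) s ∈ W) :
    stepPt v (M + 1) s' ∈ W := by
  -- `p` is `s` extended by `s'` outside of its support, and `u` is the part of `s'` which is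
  -- compatible with `s`
  set p : Fin d → ℤ := fun x => if s x = 0 then s' x else s x with hp
  set u : Fin d → ℤ := fun x => if s x = -s' x then 0 else s' x with hu
  have e1 : pat 2 (fun x => (4 : ℕ) * s x) = s ∧ pat 2 ((fun x => (4 : ℕ) * s x) + s') = s ∧
      pat 0 ((fun x => (4 : ℕ) * s x) + s') = p := by
    refine ⟨?_, ?_, ?_⟩ <;> ext x <;>
    rcases hs x with h1 | h1 | h1 <;> rcases hs' x with h2 | h2 | h2 <;> simp [pat, hp, h1, h2]
  have e2 : pat 2 ((fun x => (2 : ℕ) * s x) + fun x => (3 : ℕ) * s' x) = u ∧ pat 0 (p + u) = p ∧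
      pat 1 (p + u) = u ∧ pat 1 (s' + u) = u ∧ pat 0 (s' + u) = s' := by
    refine ⟨?_, ?_, ?_, ?_, ?_⟩ <;> ext x <;>
    rcases hs x with h1 | h1 | h1 <;> rcases hs' x with h2 | h2 | h2 <;>
    simp [pat, hp, hu, h1, h2]
  obtain ⟨-, e1, e1'⟩ := e1
  obtain ⟨e2, e3, e4, e5, e6⟩ := e2
  have hu0 : u ≠ 0 := by
    obtain ⟨x, hx, hx'⟩ := hl
    refine Function.ne_iff.mpr ⟨x, ?_⟩
    simpa [hu, hx'] using hx
  have hp0 : p ≠ 0 := by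
    obtain ⟨x, hx⟩ := Function.ne_iff.mp hs0
    refine Function.ne_iff.mpr ⟨x, ?_⟩
    simp only [Pi.zero_apply] at hx
    simp [hp, hx]
  have hf1 := (hf.nsmul (n := 4) (by norm_num)).add h.convex hvm hf'
  have hfp : Feasible Ω v p := e1' ▸ h.feasible_pat 0 hv hvm hf1
  have hfu : Feasible Ω v u := e2 ▸ h.feasible_pat 2 hv hvm
    ((hf.nsmul (n := 2) (by norm_num)).add h.convex hvm (hf'.nsmul (n := 3) (by norm_num)))
  have hwp : stepPt v (M + 2) p ∈ W := by
    have := h.step_mono (i := 0) (j := 2) (hv.add 1) hvm hf1 (by norm_num)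
    rw [e1, e1'] at this
    exact this hs0 hw
  have hwu : stepPt v (M + 1) u ∈ W := by
    have := h.step_double 1 (j := 0) hv hvm (hfp.add h.convex hvm hfu)
    rw [e3, e4] at this
    exact this hp0 hwp
  have := h.step_mono (i := 0) (j := 1) hv hvm (hf'.add h.convex hvm hfu) (by norm_num)
  rw [e5, e6] at this
  exact this hu0 hwu

lemma StarClosed.exists_linked (h : StarClosed Ω W) {M : ℕ} (hv : IsLattice M v) (hvm : v ∈ Ω)
    (hs : IsSignVec s) (hs0 : s ≠ 0) (hs0' : s' ≠ 0) (hf : Feasible Ω v s)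
    (hf' : Feasible Ω v s') (hl : ¬ Linked s s')
    (hrich : ∃ r, Feasible Ω v r ∧ ∀ c : ℤ, r + c • s ≠ 0) :
    ∃ u, IsSignVec u ∧ u ≠ 0 ∧ Feasible Ω v u ∧ Linked s u ∧ Linked u s' := by
  have hop : ∀ x, s' x ≠ 0 → s x = -s' x := by
    intro x hx
    by_contra hne
    exact hl ⟨x, hx, hne⟩
  by_cases hsum : s + s' = 0
  · obtain ⟨r, hr, hrs⟩ := hrich
    have hs'eq : ∀ x, s' x = -s x := fun x => by
      have := congrFun hsum x
      simp only [Pi.add_apply, Pi.zero_apply] at this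
      omega
    obtain ⟨x₁, hx₁⟩ := Function.ne_iff.mp hs0
    obtain ⟨x₀, hx₀, hmin⟩ := Finset.exists_min_image (Finset.univ.filter fun x => s x ≠ 0)
      (fun x => s x * r x) ⟨x₁, by simpa using hx₁⟩
    simp only [Finset.mem_filter, Finset.mem_univ, true_and] at hx₀ hmin
    set c : ℤ := -(s x₀ * r x₀) with hc
    have hcs : Feasible Ω v (c • s) := by
      rcases lt_trichotomy c 0 with h0 | h0 | h0
      · convert hf'.nsmul (n := c.natAbs) (by omega) using 1
        ext x
        simp only [Pi.smul_apply, smul_eq_mul, hs'eq]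
        rw [show ((c.natAbs : ℕ) : ℤ) = -c by omega]
        ring
      · refine ⟨1, one_pos, ?_⟩
        rw [h0]
        convert hvm using 1
        ext x
        simp
      · convert hf.nsmul (n := c.natAbs) (by omega) using 1
        ext x
        simp only [Pi.smul_apply, smul_eq_mul]
        rw [show ((c.natAbs : ℕ) : ℤ) = c by omega]
    have hpat : ∀ x, pat 0 (r + c • s) x = (r x + c * s x).sign := by
      intro x
      simp only [pat, Pi.add_apply, Pi.smul_apply, smul_eq_mul]
      split_ifs with hz
      · rfl
      · rw [show r x + c * s x = 0 by simpa using hz]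
        rfl
    have hsq : ∀ x, s x ≠ 0 → s x * s x = 1 := by
      intro x hx
      rcases hs x with h1 | h1 | h1
      · rw [h1]; rfl
      · exact absurd h1 hx
      · rw [h1]; rfl
    have hzero : r x₀ + c * s x₀ = 0 := by
      have := hsq x₀ hx₀
      rw [hc]
      linear_combination -r x₀ * this
    have hu0 : pat 0 (r + c • s) ≠ 0 := by
      obtain ⟨x, hx⟩ := Function.ne_iff.mp (hrs c)
      refine Function.ne_iff.mpr ⟨x, ?_⟩
      rw [hpat]
      simpa using hx
    refine ⟨pat 0 (r + c • s), isSignVec_pat _ _, hu0,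
      h.feasible_pat 0 hv hvm (hr.add h.convex hvm hcs), ?_, x₀, ?_, ?_⟩
    · obtain ⟨x, hx⟩ := Function.ne_iff.mp hu0
      refine ⟨x, hx, fun heq => ?_⟩
      simp only [Pi.zero_apply] at hx
      have hsx : s x ≠ 0 := by omega
      have h1 : 0 ≤ s x * (r x + c * s x) := by
        have h2 := hmin x hsx
        have h3 := hsq x hsx
        have : s x * (r x + c * s x) = s x * r x - s x₀ * r x₀ := by
          rw [hc]
          linear_combination (-(s x₀ * r x₀)) * h3
        omega
      rw [hpat] at hx heq
      have h4 : 0 < (r x + c * s x).sign * (r x + c * s x) := by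
        rw [Int.sign_mul_self_eq_abs]
        exact abs_pos.mpr (fun h0 => hx (by rw [h0]; rfl))
      have h5 : (r x + c * s x).sign = -s x := by omega
      rw [h5] at h4
      linarith
    · rw [hs'eq]
      omega
    · rw [hpat, hzero, hs'eq]
      simp only [Int.sign_zero]
      omega
  · obtain ⟨x, hx⟩ := Function.ne_iff.mp hsum
    obtain ⟨y, hy⟩ := Function.ne_iff.mp hs0'
    simp only [Pi.add_apply, Pi.zero_apply] at hx hy
    refine ⟨s + s', fun z => ?_, hsum, hf.add h.convex hvm hf', ⟨x, hx, ?_⟩, y, hy, ?_⟩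
    · have := hop z
      have := hs z
      simp only [Pi.add_apply]
      omega
    · have := hop x
      simp only [Pi.add_apply]
      omega
    · have := hop y hy
      simp only [Pi.add_apply]
      omega

lemma StarClosed.step_of_finer (h : StarClosed Ω W) {M : ℕ} (hv : IsLattice M v) (hvm : v ∈ Ω)
    (hs : IsSignVec s) (hs' : IsSignVec s') (hs0 : s ≠ 0) (hs0' : s' ≠ 0) (hf : Feasible Ω v s)
    (hf' : Feasible Ω v s') (hrich : ∃ r, Feasible Ω v r ∧ ∀ c : ℤ, r + c • s ≠ 0) (t : ℕ)
    (hl : t = 0 → Linked s s') (hw : stepPt v (M + 2 + t) s ∈ W) : stepPt v (M + 1) s' ∈ W := by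
  induction t with
  | zero => exact h.step_of_linked hv hvm hs hs' hs0 hf hf' (hl rfl) hw
  | succ t ih =>
    have hw' : stepPt v (M + (t + 1) + 2) s ∈ W := by
      rwa [show M + (t + 1) + 2 = M + 2 + (t + 1) by ring]
    by_cases ht : t = 0 ∧ ¬ Linked s s'
    · obtain ⟨rfl, hl'⟩ := ht
      obtain ⟨u, hu, hu0, hfu, hsu, hus⟩ :=
        h.exists_linked hv hvm hs hs0 hs0' hf hf' hl' hrich
      exact h.step_of_linked hv hvm hu hs' hu0 hfu hf' hus
        (h.step_of_linked (hv.add 1) hvm hs hu hs0 hf hfu hsu hw')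
    · refine ih (fun h0 => by tauto) ?_
      have := h.step_of_linked (hv.add (t + 1)) hvm hs hs hs0 hf hf (.self hs0) hw'
      rwa [show M + 2 + t = M + (t + 1) + 1 by ring]

end StarClosed

lemma exists_feasible_notMem_span (hd : 2 ≤ d) (π : Equiv.Perm (Fin d)) {M : ℕ} {v : Pt d}
    (hv : IsLattice M v) (s : Fin d → ℤ) :
    ∃ r, Feasible (kuhnSimplex d π).hull v r ∧ ∀ c : ℤ, r + c • s ≠ 0 := by
  obtain ⟨n, hn⟩ := hv
  by_contra! hcon
  have key : ∀ i : Fin (d + 1), ∃ c : ℤ, ∀ x,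
      2 ^ M * (if (π.symm x : ℕ) < (i : ℕ) then 1 else 0) - n x + c * s x = 0 := by
    intro i
    have hf : Feasible (kuhnSimplex d π).hull v
        (fun x => 2 ^ M * (if (π.symm x : ℕ) < (i : ℕ) then 1 else 0) - n x) := by
      refine ⟨(1 / 2 : ℝ) ^ M, by positivity, ?_⟩
      convert (kuhnSimplex d π).vertex_mem_hull i using 1
      ext x
      have h2 : (1 / 2 : ℝ) ^ M * 2 ^ M = 1 := by rw [← mul_pow]; norm_num
      simp only [Pi.add_apply, Pi.smul_apply, smul_eq_mul, hn, kuhnSimplex]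
      push_cast
      rw [mul_sub, ← mul_assoc, h2]
      ring
    obtain ⟨c, hc⟩ := hcon _ hf
    exact ⟨c, fun x => congrFun hc x⟩
  obtain ⟨a, ha⟩ := key ⟨0, by omega⟩
  obtain ⟨b, hb⟩ := key ⟨1, by omega⟩
  obtain ⟨c, hc⟩ := key ⟨2, by omega⟩
  have a0 := ha (π ⟨0, by omega⟩)
  have b0 := hb (π ⟨0, by omega⟩)
  have c0 := hc (π ⟨0, by omega⟩)
  have b1 := hb (π ⟨1, by omega⟩)
  have c1 := hc (π ⟨1, by omega⟩)
  simp only [Equiv.symm_apply_apply] at a0 b0 c0 b1 c1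
  norm_num at a0 b0 c0 b1 c1
  have hpow : (2 : ℤ) ^ M ≠ 0 := by positivity
  have hs0 : s (π ⟨0, by omega⟩) ≠ 0 := by
    intro h0
    rw [h0] at a0 b0
    apply hpow
    linarith
  have hbc : b = c := mul_right_cancel₀ hs0 (by linarith)
  rw [hbc] at b1
  apply hpow
  linarith

/-- An edge at `v` runs from `v` in a sign direction with a dyadic step size, and the number of
nonzero entries of the direction determines the generation of its midpoint. -/
lemma exists_edge_eq_stepPt (hd : 0 < d) {π : Equiv.Perm (Fin d)} (S : ColoredSetup d)
    (hS : S.T0 = {kuhnSimplex d π}) {𝒯 : Finset (Simplex d)} (h𝒯 : 𝒯 ∈ Bisec S.T0)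
    {e : Sym2 (Pt d)} (he : e ∈ edgesOf 𝒯) {v : Pt d} (hve : v ∈ e) :
    ∃ m σ, IsLattice m v ∧ v ∈ (kuhnSimplex d π).hull ∧ IsSignVec σ ∧ σ ≠ 0 ∧
      Feasible (kuhnSimplex d π).hull v σ ∧ e = s(v, stepPt v m σ) ∧
      stepPt v m σ ∈ verticesOf 𝒯 ∧ edgeMid e = stepPt v (m + 1) σ ∧
      S.genSharpE e + (Finset.univ.filter fun x => σ x ≠ 0).card = (m + 1) * d + 1 := by
  have hmem : ∀ w ∈ e, w ∈ verticesOf 𝒯 := by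
    intro w hw
    simp only [edgesOf, Set.mem_iUnion] at he
    obtain ⟨T, hT, i, j, -, rfl⟩ := he
    rcases Sym2.mem_iff.mp hw with rfl | rfl <;> exact mem_verticesOf.mpr ⟨T, hT, _, rfl⟩
  obtain ⟨D, hD, rfl⟩ : ∃ D, MemM S.T0 D ∧ D.bse = e := by
    simp only [edgesOf, Set.mem_iUnion] at he
    obtain ⟨T, hT, i, j, hij, rfl⟩ := he
    have hTM := h𝒯.1.memM hT
    rcases lt_or_gt_of_ne hij with h | h
    · exact exists_bse_eq hd hTM h
    · rw [Sym2.eq_swap]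
      exact exists_bse_eq hd hTM h
  have hgen : S.genSharpE D.bse = D.gen + 1 := S.vgen_bsv D hD
  have hmid : edgeMid D.bse = midpoint ℝ (D.vertex 0) (D.vertex D.kIdx) := rfl
  have hD' := hD
  rw [hS] at hD'
  obtain ⟨m, k, c, ε, τ, hF, hk, -⟩ := exists_hasForm hd hD'
  set ρ : Fin d → ℤ := fun x => if τ x < k then ε x else 0 with hρ
  have hρs : IsSignVec ρ := by
    intro x
    have := hF.sign x
    simp only [hρ]
    split_ifs <;> omega
  have hρne : ∀ x, ρ x ≠ 0 ↔ τ x < k := by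
    intro x
    have := hF.sign x
    simp only [hρ]
    split_ifs with h <;> simp [h]
    omega
  have hcard : (Finset.univ.filter fun x => ρ x ≠ 0).card = k := by
    simp only [hρne]
    exact hF.card_filter_lt
  have hρ0 : ρ ≠ 0 := by
    rintro h
    simp only [h, Pi.zero_apply, ne_eq, not_true_eq_false, Finset.filter_false,
      Finset.card_empty] at hcard
    omega
  have hv0 : ∀ x, D.vertex 0 x = (1 / 2 : ℝ) ^ m * c x := fun x => by simp [hF.vertex]
  have hvk : ∀ x, D.vertex D.kIdx x = (1 / 2 : ℝ) ^ m * (c x + ρ x) := fun x => by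
    simp [hF.vertex, hF.k_eq hk, hρ]
  have hΩ : ∀ i, D.vertex i ∈ (kuhnSimplex d π).hull := fun i =>
    hD'.hull_subset (D.vertex_mem_hull i)
  have hgen' : S.genSharpE D.bse + k = (m + 1) * d + 1 := by
    have := hF.gen
    rw [hgen]
    zify at this
    linarith
  have main : ∀ {a b : Fin (d + 1)} {σ : Fin d → ℤ}, D.bse = s(D.vertex a, D.vertex b) →
      IsLattice m (D.vertex a) → (∀ x, D.vertex b x = D.vertex a x + (1 / 2 : ℝ) ^ m * σ x) →
      IsSignVec σ → σ ≠ 0 → (Finset.univ.filter fun x => σ x ≠ 0).card = k →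
      ∃ m σ, IsLattice m (D.vertex a) ∧ D.vertex a ∈ (kuhnSimplex d π).hull ∧ IsSignVec σ ∧ σ ≠ 0 ∧
      Feasible (kuhnSimplex d π).hull (D.vertex a) σ ∧
      D.bse = s(D.vertex a, stepPt (D.vertex a) m σ) ∧
      stepPt (D.vertex a) m σ ∈ verticesOf 𝒯 ∧ edgeMid D.bse = stepPt (D.vertex a) (m + 1) σ ∧
      S.genSharpE D.bse + (Finset.univ.filter fun x => σ x ≠ 0).card = (m + 1) * d + 1 := by
    intro a b σ hbse hlat hb hσ hσ0 hσc
    have hb' : D.vertex b = stepPt (D.vertex a) m σ := funext hb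
    refine ⟨m, σ, hlat, hΩ a, hσ, hσ0, ⟨(1 / 2 : ℝ) ^ m, by positivity, ?_⟩, ?_, ?_, ?_, ?_⟩
    · convert hΩ b using 1
      ext x
      simp [hb]
    · rw [hbse, hb']
    · rw [← hb']
      exact hmem _ (by rw [hbse]; exact Sym2.mem_mk_right _ _)
    · rw [hbse, hb']
      ext x
      simp only [edgeMid, Sym2.lift_mk, stepPt, midpoint_eq_smul_add, Pi.smul_apply, Pi.add_apply,
        smul_eq_mul, pow_succ]
      rw [show (⅟2 : ℝ) = 1 / 2 by norm_num]
      ring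
    · rw [hσc]
      exact hgen'
  rcases Sym2.mem_iff.mp hve with rfl | rfl
  · refine main rfl ⟨c, hv0⟩ (fun x => ?_) hρs hρ0 hcard
    rw [hv0, hvk]
    ring
  · refine main (b := 0) (σ := -ρ) Sym2.eq_swap ⟨c + ρ, fun x => ?_⟩ (fun x => ?_) (fun x => ?_)
      (neg_ne_zero.mpr hρ0) (by simpa using hcard)
    · rw [hvk]
      simp
    · rw [hv0, hvk]
      simp
      ring
    · have := hρs x
      simp only [Pi.neg_apply]
      omega

lemma typZ_add_two_mul (hd : 0 < d) (g : ℤ) : typZ d (g + 2 * d) = typZ d g := by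
  have hd' : (d : ℤ) ≠ 0 := by omega
  unfold typZ lvlZ
  rw [show g + 2 * d + d - 1 = (g + d - 1) + 2 * d by ring, Int.add_mul_ediv_right _ _ hd']
  ring

/-- The difference of the generations of two edges at `v` is at most `2 * d`, and in the case of
equality the two edges are opposite to each other. -/
lemma genSharpE_sub_le (hd : 2 ≤ d) {π : Equiv.Perm (Fin d)} (S : ColoredSetup d)
    (hS : S.T0 = {kuhnSimplex d π}) {𝒯 : Finset (Simplex d)} (h𝒯 : 𝒯 ∈ Bisec S.T0)
    {e e' : Sym2 (Pt d)} (he : e ∈ edgesOf 𝒯) (he' : e' ∈ edgesOf 𝒯) {v : Pt d} (hve : v ∈ e)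
    (hve' : v ∈ e') :
    S.genSharpE e - S.genSharpE e' ≤ 2 * d ∧ (S.genSharpE e - S.genSharpE e' = 2 * d →
      ∃ w w', e = s(v, w) ∧ e' = s(v, w') ∧ w' - v = (-4 : ℝ) • (w - v)) := by
  have hd0 : 0 < d := by omega
  obtain ⟨m, σ, -, hvm, hσ, hσ0, hf, hes, hw, -, hg⟩ :=
    exists_edge_eq_stepPt hd0 S hS h𝒯 he hve
  obtain ⟨m', σ', hv, -, hσ', hσ0', hf', hes', -, hmid, hg'⟩ :=
    exists_edge_eq_stepPt hd0 S hS h𝒯 he' hve'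
  have hnot : stepPt v (m' + 1) σ' ∉ verticesOf 𝒯 := hmid ▸ edgeMid_notMem hd0 S h𝒯 he'
  have hfin := fun t hl => (starClosed hd0 S hS h𝒯).step_of_finer hv hvm hσ hσ' hσ0 hσ0' hf hf'
    (exists_feasible_notMem_span hd π hv σ) t hl
  set L := (Finset.univ.filter fun x => σ x ≠ 0).card with hL
  set L' := (Finset.univ.filter fun x => σ' x ≠ 0).card with hL'
  have hLpos : 1 ≤ L := by
    obtain ⟨x, hx⟩ := Function.ne_iff.mp hσ0
    exact Finset.card_pos.mpr ⟨x, by simpa using hx⟩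
  have hLd' : L' ≤ d := (Finset.card_filter_le _ _).trans (by simp)
  have key : 2 * (d : ℤ) ≤ S.genSharpE e - S.genSharpE e' → m = m' + 2 ∧ σ' = -σ ∧ L = L' := by
    intro hge
    have hge' : (m : ℤ) * d + L' ≥ (m' + 2) * d + L := by linarith
    have hm : m' + 2 ≤ m := by
      by_contra! hlt
      have h1 : (m : ℤ) + 1 ≤ m' + 2 := by omega
      have h2 : ((m : ℤ) + 1) * d ≤ (m' + 2) * d := by gcongr
      have h3 : (L' : ℤ) ≤ d := by exact_mod_cast hLd'
      have h4 : (1 : ℤ) ≤ L := by exact_mod_cast hLpos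
      linarith
    obtain ⟨t, rfl⟩ := Nat.exists_eq_add_of_le hm
    have ht : t = 0 ∧ ¬ Linked σ σ' := by
      by_contra hcon
      exact hnot (hfin t (fun h0 => by tauto) hw)
    obtain ⟨rfl, hl⟩ := ht
    have hop : ∀ x, σ' x ≠ 0 → σ x = -σ' x := by
      intro x hx
      by_contra hne
      exact hl ⟨x, hx, hne⟩
    have hsub : (Finset.univ.filter fun x => σ' x ≠ 0) ⊆ Finset.univ.filter fun x => σ x ≠ 0 := by
      intro x hx
      simp only [Finset.mem_filter, Finset.mem_univ, true_and] at hx ⊢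
      have := hop x hx
      omega
    have hLL : L ≤ L' := by
      push_cast at hge'
      have : (L : ℤ) ≤ L' := by linarith
      exact_mod_cast this
    have heq := Finset.eq_of_subset_of_card_le hsub hLL
    refine ⟨rfl, ?_, le_antisymm hLL (Finset.card_le_card hsub)⟩
    ext x
    rw [Pi.neg_apply]
    by_cases hx : σ' x = 0
    · have : x ∉ Finset.univ.filter fun x => σ x ≠ 0 := by
        rw [← heq]
        simpa using hx
      have : σ x = 0 := by simpa using this
      omega
    · have := hop x hx
      omega
  constructor
  · by_contra! hlt
    obtain ⟨rfl, -, hLL⟩ := key hlt.le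
    rw [hLL] at hg
    push_cast at hg
    linarith
  · intro heq
    obtain ⟨rfl, rfl, -⟩ := key heq.ge
    refine ⟨_, _, hes, hes', ?_⟩
    ext x
    simp only [stepPt, Pi.sub_apply, Pi.smul_apply, Pi.neg_apply, smul_eq_mul, pow_add]
    push_cast
    ring

theorem gensharp_kuhn (d : ℕ) (hd : 2 ≤ d) (π : Equiv.Perm (Fin d))
    (S : ColoredSetup d) (hS : S.T0 = {kuhnSimplex d π})
    (𝒯 : Finset (Simplex d)) (h𝒯 : 𝒯 ∈ Bisec S.T0)
    (v : Pt d) (hv : v ∈ verticesOf 𝒯)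
    (e e' : Sym2 (Pt d)) (he : e ∈ edgesOf 𝒯) (he' : e' ∈ edgesOf 𝒯)
    (hve : v ∈ e) (hve' : v ∈ e') :
    S.genSharpE e - S.genSharpE e' ≤ 2 * d ∧
    (S.genSharpE e - S.genSharpE e' = 2 * d → S.typSharpE e = S.typSharpE e') ∧
    (S.genSharpE e - S.genSharpE e' = 2 * d →
      (S.typSharpE e = 1 ∨ S.typSharpE e = d) →
      (∀ e'' ∈ edgesOf 𝒯, v ∈ e'' → S.genSharpE e - S.genSharpE e'' = 2 * d → e'' = e') ∧
      (∀ e'' ∈ edgesOf 𝒯, v ∈ e'' → S.genSharpE e'' - S.genSharpE e' = 2 * d → e'' = e)) := by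
  have main := fun {e e'} (he : e ∈ edgesOf 𝒯) (he' : e' ∈ edgesOf 𝒯) (hve : v ∈ e)
    (hve' : v ∈ e') => genSharpE_sub_le hd S hS h𝒯 he he' hve hve'
  refine ⟨(main he he' hve hve').1, fun h => ?_, fun h _ => ⟨fun e'' he'' hve'' h'' => ?_,
    fun e'' he'' hve'' h'' => ?_⟩⟩
  · unfold ColoredSetup.typSharpE
    rw [show S.genSharpE e = S.genSharpE e' + 2 * d by linarith, typZ_add_two_mul (by omega)]
  · obtain ⟨w, w', hw, hw', hww⟩ := (main he he' hve hve').2 h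
    obtain ⟨u, u', hu, hu', huu⟩ := (main he he'' hve hve'').2 h''
    obtain rfl : w = u := Sym2.congr_right.mp (hw.symm.trans hu)
    rw [hw', hu', sub_left_injective (huu.trans hww.symm)]
  · obtain ⟨w, w', hw, hw', hww⟩ := (main he he' hve hve').2 h
    obtain ⟨u, u', hu, hu', huu⟩ := (main he'' he' hve'' hve').2 h''
    obtain rfl : w' = u' := Sym2.congr_right.mp (hw'.symm.trans hu')
    have := smul_right_injective (Pt d) (by norm_num : (-4 : ℝ) ≠ 0) (huu.symm.trans hww)
    rw [hw, hu, sub_left_injective this]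

end BisecGrading
end
end

section
/- Let 𝒯_0 be a colored initial triangulation, let 𝒯 ∈ Bisec(𝒯_0), and let e_1,…,e_N ∈ ℰ(𝒯) with N ∈ ℕ be a chain of edges with vertices v_0,…,v_N ∈ 𝒱(𝒯) (i.e. e_j = [v_{j−1}, v_j] for j = 1,…,N). Let m ∈ ℕ_0 satisfy level(v_0) < m. Suppose the chain leaves the neighborhood Ω_m(v_0) in the sense that v_j ∈ Ω_m(v_0) for all j = 0,…,N−1 and v_N ∉ Ω_m(v_0). Then the last edge satisfies level(e_N) < m + N. -/
noncomputable section

namespace BisecGrading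

variable {d : ℕ}

/-- `B` is a system of convex weights on the points of `A` representing the point `p`. -/
structure IsConvexRep (A : Set (Pt d)) (p : Pt d) (B : Pt d →₀ ℝ) : Prop where
  supp : ∀ x, x ∉ A → B x = 0
  nonneg : ∀ x, 0 ≤ B x
  sum_eq : Finsupp.linearCombination ℝ (fun _ => (1 : ℝ)) B = 1
  pt_eq : Finsupp.linearCombination ℝ (fun x : Pt d => x) B = p

namespace IsConvexRep

variable {d : ℕ} {A A' : Set (Pt d)} {p q : Pt d} {B B' : Pt d →₀ ℝ}

lemma mono (h : IsConvexRep A p B) (hA : A ⊆ A') : IsConvexRep A' p B :=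
  ⟨fun x hx => h.supp x fun h' => hx (hA h'), h.nonneg, h.sum_eq, h.pt_eq⟩

lemma single {x : Pt d} (hx : x ∈ A) : IsConvexRep A x (Finsupp.single x 1) := by
  refine ⟨fun y hy => ?_, fun y => ?_, by simp, by simp⟩
  · rw [Finsupp.single_eq_of_ne]
    rintro rfl
    exact hy hx
  · rw [Finsupp.single_apply]
    split_ifs <;> norm_num

lemma combo (h : IsConvexRep A p B) (h' : IsConvexRep A q B') {s t : ℝ} (hs : 0 ≤ s)
    (ht : 0 ≤ t) (hst : s + t = 1) : IsConvexRep A (s • p + t • q) (s • B + t • B') := by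
  refine ⟨fun x hx => ?_, fun x => ?_, ?_, ?_⟩
  · simp [h.supp x hx, h'.supp x hx]
  · have := h.nonneg x
    have := h'.nonneg x
    simp only [Finsupp.add_apply, Finsupp.smul_apply, smul_eq_mul]
    positivity
  · simp only [map_add, map_smul, h.sum_eq, h'.sum_eq, smul_eq_mul, mul_one, hst]
  · simp only [map_add, map_smul, h.pt_eq, h'.pt_eq]

lemma midpoint (h : IsConvexRep A p B) (h' : IsConvexRep A q B') :
    IsConvexRep A (midpoint ℝ p q) ((1 / 2 : ℝ) • B + (1 / 2 : ℝ) • B') := by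
  have := h.combo h' (s := 1 / 2) (t := 1 / 2) (by norm_num) (by norm_num) (by norm_num)
  convert this using 1
  rw [midpoint_eq_smul_add, smul_add]
  norm_num

lemma restrict (h : IsConvexRep A p B) (hA : ∀ x, x ∉ A' → B x = 0) : IsConvexRep A' p B :=
  ⟨hA, h.nonneg, h.sum_eq, h.pt_eq⟩

end IsConvexRep

lemma mem_convexHull_iff_isConvexRep {A : Set (Pt d)} (hA : A.Finite) {p : Pt d} :
    p ∈ convexHull ℝ A ↔ ∃ B, IsConvexRep A p B := by
  classical
  lift A to Finset (Pt d) using hA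
  constructor
  · rw [Finset.mem_convexHull']
    rintro ⟨w, hw, hs, hp⟩
    have hsupp : ∀ y, (if y ∈ A then w y else 0) ≠ 0 → y ∈ A := by
      intro y hy
      by_contra h
      simp [h] at hy
    refine ⟨Finsupp.onFinset A (fun y => if y ∈ A then w y else 0) hsupp, ?_, ?_, ?_, ?_⟩
    · intro x hx
      have : x ∉ A := by simpa using hx
      simp [this]
    · intro x
      rw [Finsupp.onFinset_apply]
      split_ifs with h
      exacts [hw x h, le_rfl]
    · rw [Finsupp.linearCombination_onFinset]
      exact (Finset.sum_congr rfl fun x hx => by simp [hx]).trans hs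
    · rw [Finsupp.linearCombination_onFinset]
      exact (Finset.sum_congr rfl fun x hx => by simp [hx]).trans hp
  · rintro ⟨B, hB⟩
    have hsub : B.support ⊆ A := by
      intro x hx
      by_contra h
      exact (Finsupp.mem_support_iff.1 hx) (hB.supp x (by simpa using h))
    rw [Finset.mem_convexHull']
    refine ⟨B, fun y _ => hB.nonneg y, ?_, ?_⟩
    · rw [← hB.sum_eq, Finsupp.linearCombination_apply,
        Finsupp.sum_of_support_subset _ hsub _ (by simp)]
      simp
    · rw [← hB.pt_eq, Finsupp.linearCombination_apply,
        Finsupp.sum_of_support_subset _ hsub _ (by simp)]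

namespace Simplex

variable {d : ℕ}

lemma finite_V (T : Simplex d) : T.V.Finite := Set.finite_range _

lemma mem_hull_iff {T : Simplex d} {p : Pt d} : p ∈ T.hull ↔ ∃ B, IsConvexRep T.V p B :=
  mem_convexHull_iff_isConvexRep T.finite_V

lemma V_subset_hull (T : Simplex d) : T.V ⊆ T.hull := subset_convexHull ℝ _

lemma vertex_mem (T : Simplex d) (i : Fin (d + 1)) : T.vertex i ∈ T.V := ⟨i, rfl⟩

end Simplex

lemma isConvexRep_unique {T : Simplex d} (hT : AffineIndependent ℝ T.vertex) {p : Pt d}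
    {B B' : Pt d →₀ ℝ} (h : IsConvexRep T.V p B) (h' : IsConvexRep T.V p B') : B = B' := by
  classical
  have hsum : ∀ {M : Type} [AddCommGroup M] [Module ℝ M] (f : Pt d → M) (C : Pt d →₀ ℝ),
      (∀ x, x ∉ T.V → C x = 0) →
      Finsupp.linearCombination ℝ f C = ∑ i, C (T.vertex i) • f (T.vertex i) := by
    intro M _ _ f C hC
    rw [Finsupp.linearCombination_apply,
      Finsupp.sum_of_support_subset (s := Finset.univ.image T.vertex) _ _ _ (by simp),
      Finset.sum_image fun i _ j _ hij => hT.injective hij]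
    intro x hx
    by_contra hn
    refine (Finsupp.mem_support_iff.1 hx) (hC x ?_)
    rintro ⟨i, rfl⟩
    exact hn (by simp)
  have hD : ∀ x, x ∉ T.V → (B - B') x = 0 := fun x hx => by simp [h.supp x hx, h'.supp x hx]
  have key := affineIndependent_iff.1 hT Finset.univ (fun i => (B - B') (T.vertex i))
    (by
      have := hsum (fun _ => (1 : ℝ)) (B - B') hD
      simpa [map_sub, h.sum_eq, h'.sum_eq] using this.symm)
    (by
      have := hsum (fun x => x) (B - B') hD
      simpa only [map_sub, h.pt_eq, h'.pt_eq, sub_self] using this.symm)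
  ext x
  by_cases hx : x ∈ T.V
  · obtain ⟨i, rfl⟩ := hx
    have := key i (Finset.mem_univ _)
    simpa [sub_eq_zero] using this
  · rw [h.supp x hx, h'.supp x hx]

lemma vertex_mem_of_convexHull_eq {T : Simplex d} (hT : AffineIndependent ℝ T.vertex)
    {A A' : Set (Pt d)} (hA : A ⊆ T.V) (h : convexHull ℝ A = convexHull ℝ A') : A ⊆ A' := by
  intro a ha
  have hfin := T.finite_V.subset hA
  refine extremePoints_convexHull_subset (𝕜 := ℝ) ?_
  rw [← h, mem_extremePoints]
  refine ⟨subset_convexHull ℝ _ ha, ?_⟩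
  have aux : ∀ {y z : Pt d} {s t : ℝ}, y ∈ convexHull ℝ A → z ∈ convexHull ℝ A →
      0 < s → 0 ≤ t → s + t = 1 → s • y + t • z = a → y = a := by
    intro y z s t hy hz hs ht hst hyz
    obtain ⟨B, hB⟩ := (mem_convexHull_iff_isConvexRep hfin).1 hy
    obtain ⟨C, hC⟩ := (mem_convexHull_iff_isConvexRep hfin).1 hz
    have hBC := hB.combo hC hs.le ht hst
    rw [hyz] at hBC
    have heq := isConvexRep_unique hT (hBC.mono hA)
      (IsConvexRep.single (A := T.V) (hA ha))
    have hB0 : ∀ x, x ≠ a → B x = 0 := by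
      intro x hx
      have h1 := DFunLike.congr_fun heq x
      simp only [Finsupp.add_apply, Finsupp.smul_apply, smul_eq_mul] at h1
      rw [Finsupp.single_eq_of_ne hx] at h1
      have h2 := mul_nonneg ht (hC.nonneg x)
      have h3 := hB.nonneg x
      by_contra hne
      have := mul_pos hs (lt_of_le_of_ne h3 (Ne.symm hne))
      linarith
    have hBs : B = Finsupp.single a (B a) := by
      ext x
      by_cases hx : x = a
      · subst hx; simp
      · rw [hB0 x hx, Finsupp.single_eq_of_ne hx]
    have h1 := hB.sum_eq
    have h2 := hB.pt_eq
    rw [hBs] at h1 h2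
    simp only [Finsupp.linearCombination_single, smul_eq_mul, mul_one] at h1 h2
    rw [← h2, h1, one_smul]
  rintro y hy z hz ⟨s, t, hs, ht, hst, hyz⟩
  exact ⟨aux hy hz hs ht.le hst hyz,
    aux hz hy ht hs.le (by rw [add_comm]; exact hst) (by rw [add_comm]; exact hyz)⟩

/-- The description common to both children of `T`: the first `k` vertices of `T'` are
consecutive vertices of `T`, followed by the bisection vertex and the remaining vertices. -/
structure IsBisected (T T' : Simplex d) (s : ℕ) : Prop where
  le_one : s ≤ 1
  gen_eq : T'.gen = T.gen + 1
  low : ∀ i i' : Fin (d + 1), (i : ℕ) < T.k → (i' : ℕ) = i + s → T'.vertex i = T.vertex i'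
  mid : ∀ i : Fin (d + 1), (i : ℕ) = T.k → T'.vertex i = T.bsv
  high : ∀ i : Fin (d + 1), T.k < i → T'.vertex i = T.vertex i

lemma isBisected_child1 (T : Simplex d) : IsBisected T T.child1 0 where
  le_one := by norm_num
  gen_eq := rfl
  low i i' hi hi' := by
    obtain rfl : i' = i := Fin.ext hi'
    exact Function.update_of_ne (fun h => by rw [h] at hi; exact lt_irrefl _ hi) _ _
  mid i hi := by
    obtain rfl : i = T.kIdx := Fin.ext hi
    exact Function.update_self _ _ _
  high i hi := Function.update_of_ne (fun h => by rw [h] at hi; exact lt_irrefl _ hi) _ _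

lemma isBisected_child2 (T : Simplex d) : IsBisected T T.child2 1 where
  le_one := le_rfl
  gen_eq := rfl
  low i i' hi hi' := by
    have hi'' : i' = ⟨(i : ℕ) + 1, by omega⟩ := Fin.ext hi'
    rw [hi'']
    simp [Simplex.child2, hi]
  mid i hi := by simp [Simplex.child2, hi]
  high i hi := by
    have h1 : ¬ (i : ℕ) < T.k := by omega
    have h2 : (i : ℕ) ≠ T.k := by omega
    simp [Simplex.child2, h1, h2]

lemma Simplex.IsChild.isBisected {T T' : Simplex d} (h : T'.IsChild T) :
    ∃ s, IsBisected T T' s := by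
  rcases h with rfl | rfl
  exacts [⟨0, isBisected_child1 T⟩, ⟨1, isBisected_child2 T⟩]

lemma Simplex.k_eq {T : Simplex d} {M j : ℕ} (hg : T.gen = M * d + j) (hj : j < d) :
    T.k = d - j := by
  rw [Simplex.k, hg, Nat.add_comm, Nat.add_mul_mod_self_right, Nat.mod_eq_of_lt hj]

lemma IsBisected.mem_V {T T' : Simplex d} {s : ℕ} (h : IsBisected T T' s)
    (i : Fin (d + 1)) : (T'.vertex i = T.bsv ∧ (i : ℕ) = T.k) ∨ T'.vertex i ∈ T.V := by
  rcases lt_trichotomy (i : ℕ) T.k with hi | hi | hi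
  · right
    have := T.k_le
    have := h.le_one
    rw [h.low i ⟨i + s, by omega⟩ hi rfl]
    exact T.vertex_mem _
  · exact Or.inl ⟨h.mid i hi, hi⟩
  · right
    rw [h.high i hi]
    exact T.vertex_mem _

lemma IsBisected.V_subset {T T' : Simplex d} {s : ℕ} (h : IsBisected T T' s) :
    T'.V ⊆ insert T.bsv T.V := by
  rintro _ ⟨i, rfl⟩
  rcases h.mem_V i with hi | hi
  exacts [Or.inl hi.1, Or.inr hi]

/-- The generation of a simplex is `M * d + j`, its first `d - j + 1` vertices are the
consecutive vertices number `a, …, a + d - j` of an ancestor of generation `M * d`, and the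
vertices created since then carry the remaining positions. -/
structure VertexGenerations (S : ColoredSetup d) (T : Simplex d) (M j a : ℕ) : Prop where
  gen_eq : T.gen = M * d + j
  lt : j < d
  le : a ≤ j
  zero : ∀ i : Fin (d + 1), (i : ℕ) ≤ d - j → a + i = 0 → S.vgen (T.vertex i) ≤ (M : ℤ) * d - d
  old : ∀ i : Fin (d + 1), (i : ℕ) ≤ d - j → 0 < a + i →
    S.vgen (T.vertex i) = (M : ℤ) * d - (a + i) + 1
  new : ∀ i : Fin (d + 1), d - j < (i : ℕ) → S.vgen (T.vertex i) = (M : ℤ) * d + d - i + 1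

namespace VertexGenerations

variable {S : ColoredSetup d} {T T' : Simplex d} {M j a : ℕ}

lemma vgen_le_gen (h : VertexGenerations S T M j a) (i : Fin (d + 1)) :
    S.vgen (T.vertex i) ≤ T.gen := by
  have h1 := h.lt
  have h2 := h.le
  have h3 := i.2
  rw [h.gen_eq]
  push_cast
  by_cases hi : (i : ℕ) ≤ d - j
  · by_cases h0 : a + i = 0
    · have := h.zero i hi h0
      omega
    · have := h.old i hi (by omega)
      omega
  · have := h.new i (by omega)
    omega

lemma injective (h : VertexGenerations S T M j a) : Function.Injective T.vertex := by
  intro i i' hii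
  have h1 := h.lt
  have h2 := h.le
  have h3 := i.2
  have h4 := i'.2
  have e : S.vgen (T.vertex i) = S.vgen (T.vertex i') := by rw [hii]
  have f1 := h.zero i
  have f2 := h.old i
  have f3 := h.new i
  have g1 := h.zero i'
  have g2 := h.old i'
  have g3 := h.new i'
  apply Fin.ext
  generalize (M : ℤ) * d = X at *
  omega

lemma k_eq (h : VertexGenerations S T M j a) : T.k = d - j := Simplex.k_eq h.gen_eq h.lt

lemma low_vertex_of_eq {b : ℕ} (h : VertexGenerations S T M j a)
    (h' : VertexGenerations S T' M j b) {i i' : Fin (d + 1)} (hi : (i : ℕ) ≤ d - j)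
    (hii : T.vertex i = T'.vertex i') : (i' : ℕ) ≤ d - j ∧ a + i = b + i' := by
  have h1 := h.lt
  have h2 := h.le
  have h2' := h'.le
  have h3 := i.2
  have h4 := i'.2
  have e : S.vgen (T.vertex i) = S.vgen (T'.vertex i') := by rw [hii]
  have f1 := h.zero i hi
  have f2 := h.old i hi
  have g1 := h'.zero i'
  have g2 := h'.old i'
  have g3 := h'.new i'
  generalize (M : ℤ) * d = X at *
  omega

lemma eq_of_gen_eq {M' j' b : ℕ} (h : VertexGenerations S T M j a)
    (h' : VertexGenerations S T' M' j' b) (hg : T.gen = T'.gen) : M = M' ∧ j = j' := by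
  have e : M * d + j = M' * d + j' := by rw [← h.gen_eq, ← h'.gen_eq, hg]
  have h1 := h.lt
  have h2 := h'.lt
  have hM : M = M' := by
    rcases lt_trichotomy M M' with hl | hl | hl
    · have := Nat.mul_le_mul_right d (Nat.succ_le_of_lt hl)
      rw [Nat.succ_mul] at this
      omega
    · exact hl
    · have := Nat.mul_le_mul_right d (Nat.succ_le_of_lt hl)
      rw [Nat.succ_mul] at this
      omega
  subst hM
  exact ⟨rfl, by omega⟩

/-- A simplex containing the bisection edge of a simplex of the same generation has the same
bisection edge. -/
lemma bse_eq {M' j' b : ℕ} (h : VertexGenerations S T M j a)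
    (h' : VertexGenerations S T' M' j' b) (hg : T.gen = T'.gen)
    (h0 : T.vertex 0 ∈ T'.V) (hk : T.vertex T.kIdx ∈ T'.V) :
    T'.vertex 0 = T.vertex 0 ∧ T'.vertex T'.kIdx = T.vertex T.kIdx := by
  obtain ⟨rfl, rfl⟩ := h.eq_of_gen_eq h' hg
  obtain ⟨i, hi⟩ := h0
  obtain ⟨i', hi'⟩ := hk
  have k1 : (T.kIdx : ℕ) = d - j := h.k_eq
  have k2 : (T'.kIdx : ℕ) = d - j := h'.k_eq
  have e1 := h.low_vertex_of_eq h' (i := 0) (by simp) hi.symm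
  have e2 := h.low_vertex_of_eq h' (i := T.kIdx) k1.le hi'.symm
  have h3 : ((0 : Fin (d + 1)) : ℕ) = 0 := rfl
  rw [h3] at e1
  have r1 : i = 0 := Fin.ext (by rw [h3]; omega)
  have r2 : i' = T'.kIdx := Fin.ext (by omega)
  rw [← hi, ← hi', r1, r2]
  exact ⟨rfl, rfl⟩

lemma child (h : VertexGenerations S T M j a) {s : ℕ} (hb : IsBisected T T' s)
    (hv : S.vgen T.bsv = (T.gen : ℤ) + 1) : ∃ M j a, VertexGenerations S T' M j a := by
  have h1 := h.lt
  have h2 := h.le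
  have hs := hb.le_one
  have hk := h.k_eq
  rw [h.gen_eq] at hv
  push_cast at hv
  have low : ∀ i : Fin (d + 1), (i : ℕ) < d - j →
      ((a + s + i = 0 → S.vgen (T'.vertex i) ≤ (M : ℤ) * d - d) ∧ (0 < a + s + i →
        S.vgen (T'.vertex i) = (M : ℤ) * d - (a + s + i) + 1)) := by
    intro i hi
    rw [hb.low i ⟨i + s, by omega⟩ (by omega) rfl]
    have f1 := h.zero ⟨i + s, by omega⟩
    have f2 := h.old ⟨i + s, by omega⟩
    simp only at f1 f2
    push_cast at f1 f2
    constructor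
    · intro h0
      exact f1 (by omega) (by omega)
    · intro h0
      rw [f2 (by omega) (by omega)]
      ring
  have high : ∀ i : Fin (d + 1), d - j ≤ (i : ℕ) →
      S.vgen (T'.vertex i) = (M : ℤ) * d + d - i + 1 := by
    intro i hi
    rcases hi.eq_or_lt with hi | hi
    · rw [hb.mid i (by omega), hv]
      omega
    · rw [hb.high i (by omega)]
      exact h.new i hi
  by_cases hj : j + 1 < d
  · refine ⟨M, j + 1, a + s, ?_, hj, by omega, fun i hi h0 => ?_, fun i hi h0 => ?_,
      fun i hi => high i (by omega)⟩
    · rw [hb.gen_eq, h.gen_eq, add_assoc]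
    · exact (low i (by omega)).1 h0
    · have := (low i (by omega)).2 h0
      push_cast
      exact this
  · have hj' : j + 1 = d := by omega
    refine ⟨M + 1, 0, 0, ?_, by omega, le_rfl, fun i hi h0 => ?_, fun i hi h0 => ?_,
      fun i hi => ?_⟩
    · rw [hb.gen_eq, h.gen_eq, add_assoc, hj', Nat.succ_mul, add_zero]
    · have f := low i (by omega)
      push_cast
      rw [add_mul, one_mul]
      generalize (M : ℤ) * d = X at *
      omega
    · have f := high i (by omega)
      push_cast
      rw [add_mul, one_mul]
      generalize (M : ℤ) * d = X at *
      omega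
    · have := i.2
      omega

end VertexGenerations

lemma exists_vertexGenerations (hd : 0 < d) (S : ColoredSetup d) {T : Simplex d}
    (hT : MemM S.T0 T) : ∃ M j a, VertexGenerations S T M j a := by
  induction hT with
  | @init T hT =>
    refine ⟨0, 0, 0, ?_, hd, le_rfl, fun i hi h0 => ?_, fun i hi h0 => ?_, fun i hi => ?_⟩
    · rw [S.gen_zero T hT, zero_mul]
    · obtain rfl : i = 0 := Fin.ext (by simpa using h0)
      rw [S.vgen_init T hT, S.color_zero T hT]
      simp
    · rw [S.vgen_init T hT, S.color_succ T hT i (by omega)]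
      push_cast
      omega
    · have := i.2
      omega
  | @child T T' hT hc ih =>
    obtain ⟨M, j, a, h⟩ := ih
    obtain ⟨s, hs⟩ := hc.isBisected
    exact h.child hs (S.vgen_bsv T hT)

lemma vgen_le_gen (hd : 0 < d) (S : ColoredSetup d) {T : Simplex d} (hT : MemM S.T0 T)
    {x : Pt d} (hx : x ∈ T.V) : S.vgen x ≤ T.gen := by
  obtain ⟨M, j, a, h⟩ := exists_vertexGenerations hd S hT
  obtain ⟨i, rfl⟩ := hx
  exact h.vgen_le_gen i

/-- Transfer of convex weights to a bisection: the weight common to the end points `x` and `y`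
of the bisection edge moves to its midpoint `z`. -/
def bisectWeights (x y z : Pt d) (B : Pt d →₀ ℝ) : Pt d →₀ ℝ :=
  B + min (B x) (B y) •
    (Finsupp.single z 2 - Finsupp.single x 1 - Finsupp.single y 1)

lemma bisectWeights_of_min_eq_zero {x y z : Pt d} {B : Pt d →₀ ℝ} (h : min (B x) (B y) = 0) :
    bisectWeights x y z B = B := by
  simp [bisectWeights, h]

lemma IsBisected.not_both_mem {S : ColoredSetup d} {T T' : Simplex d} {M j a s : ℕ}
    (h : VertexGenerations S T M j a) (hb : IsBisected T T' s) (hz : T.bsv ∉ T.V) :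
    T.vertex 0 ∉ T'.V ∨ T.vertex T.kIdx ∉ T'.V := by
  by_contra! hcon
  obtain ⟨⟨i, hi⟩, i', hi'⟩ := hcon
  have hs := hb.le_one
  have hk := h.k_eq
  have hlt := h.lt
  have hkd := T.k_le
  have key : ∀ (i l : Fin (d + 1)), T'.vertex i = T.vertex l →
      ((i : ℕ) < T.k ∧ (l : ℕ) = i + s) ∨ (T.k < i ∧ l = i) := by
    intro i l hil
    rcases lt_trichotomy (i : ℕ) T.k with h1 | h1 | h1
    · rw [hb.low i ⟨i + s, by omega⟩ h1 rfl] at hil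
      exact Or.inl ⟨h1, by rw [← h.injective hil]⟩
    · rw [hb.mid i h1] at hil
      exact absurd (hil ▸ T.vertex_mem l) hz
    · rw [hb.high i h1] at hil
      exact Or.inr ⟨h1, (h.injective hil).symm⟩
  have h0 : ((0 : Fin (d + 1)) : ℕ) = 0 := rfl
  have hkk : (T.kIdx : ℕ) = T.k := rfl
  rcases key i 0 hi with ⟨h1, h2⟩ | ⟨h1, h2⟩
  · rcases key i' T.kIdx hi' with ⟨h3, h4⟩ | ⟨h3, h4⟩
    · omega
    · rw [← h4] at h3
      omega
  · rw [← h2] at h1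
    omega

lemma IsConvexRep.of_bisected {S : ColoredSetup d} {T T' : Simplex d} {M j a s : ℕ}
    (h : VertexGenerations S T M j a) (hb : IsBisected T T' s) (hz : T.bsv ∉ T.V)
    {p : Pt d} {B' : Pt d →₀ ℝ} (hB : IsConvexRep T'.V p B') :
    ∃ B, IsConvexRep T.V p B ∧ B' = bisectWeights (T.vertex 0) (T.vertex T.kIdx) T.bsv B := by
  have hnot := hb.not_both_mem h hz
  have hxy : T.vertex 0 ≠ T.vertex T.kIdx := by
    intro h0
    have h1 := congrArg Fin.val (h.injective h0)
    have h2 := h.k_eq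
    have h3 := h.lt
    change 0 = T.k at h1
    omega
  have hxz : T.vertex 0 ≠ T.bsv := fun h0 => hz (h0 ▸ T.vertex_mem 0)
  have hyz : T.vertex T.kIdx ≠ T.bsv := fun h0 => hz (h0 ▸ T.vertex_mem T.kIdx)
  have hsub := hb.V_subset
  have hmid : T.bsv = (1 / 2 : ℝ) • T.vertex 0 + (1 / 2 : ℝ) • T.vertex T.kIdx := by
    rw [Simplex.bsv, midpoint_eq_smul_add, smul_add]
    norm_num
  have hxV := T.vertex_mem 0
  have hyV := T.vertex_mem T.kIdx
  generalize T.vertex 0 = x at *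
  generalize T.vertex T.kIdx = y at *
  generalize T.bsv = z at *
  classical
  set B : Pt d →₀ ℝ := B' + B' z •
    (Finsupp.single x (1 / 2) + Finsupp.single y (1 / 2) - Finsupp.single z 1) with hBdef
  have hBx : B x = B' x + B' z / 2 := by
    simp only [hBdef, Finsupp.add_apply, Finsupp.smul_apply, Finsupp.sub_apply,
      Finsupp.single_eq_same, Finsupp.single_eq_of_ne hxy, Finsupp.single_eq_of_ne hxz, smul_eq_mul]
    ring
  have hBy : B y = B' y + B' z / 2 := by
    simp only [hBdef, Finsupp.add_apply, Finsupp.smul_apply, Finsupp.sub_apply,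
      Finsupp.single_eq_same, Finsupp.single_eq_of_ne hxy.symm, Finsupp.single_eq_of_ne hyz,
      smul_eq_mul]
    ring
  have hBz : B z = 0 := by
    simp only [hBdef, Finsupp.add_apply, Finsupp.smul_apply, Finsupp.sub_apply,
      Finsupp.single_eq_same, Finsupp.single_eq_of_ne hxz.symm, Finsupp.single_eq_of_ne hyz.symm,
      smul_eq_mul]
    ring
  have hBo : ∀ q, q ≠ x → q ≠ y → q ≠ z → B q = B' q := by
    intro q h1 h2 h3
    simp [hBdef, Finsupp.single_eq_of_ne h1, Finsupp.single_eq_of_ne h2,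
      Finsupp.single_eq_of_ne h3]
  refine ⟨B, ⟨fun q hq => ?_, fun q => ?_, ?_, ?_⟩, ?_⟩
  · by_cases h3 : q = z
    · rw [h3, hBz]
    · rw [hBo q (fun h => hq (h ▸ hxV)) (fun h => hq (h ▸ hyV)) h3]
      refine hB.supp q fun h => ?_
      rcases hsub h with h | h
      exacts [h3 h, hq h]
  · have h1 := hB.nonneg q
    have h2 := hB.nonneg z
    by_cases hx : q = x
    · subst hx; rw [hBx]; linarith
    by_cases hy : q = y
    · subst hy; rw [hBy]; linarith
    by_cases hz' : q = z
    · subst hz'; rw [hBz]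
    rw [hBo q hx hy hz']
    exact h1
  · simp only [hBdef, map_add, map_sub, map_smul, Finsupp.linearCombination_single, hB.sum_eq,
      smul_eq_mul]
    ring
  · simp only [hBdef, map_add, map_sub, map_smul, Finsupp.linearCombination_single, hB.pt_eq,
      one_smul, hmid, sub_self, smul_zero, add_zero]
  · have hmin : min (B x) (B y) = B' z / 2 := by
      rw [hBx, hBy]
      have h1 := hB.nonneg x
      have h2 := hB.nonneg y
      rcases hnot with h | h
      · rw [hB.supp x h, min_eq_left (by linarith)]
        ring
      · rw [hB.supp y h, min_eq_right (by linarith)]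
        ring
    rw [bisectWeights, hmin, hBdef]
    ext q
    simp only [Finsupp.add_apply, Finsupp.smul_apply, Finsupp.sub_apply, smul_eq_mul,
      Finsupp.single_apply]
    split_ifs <;> ring

lemma bsv_notMem (hd : 0 < d) (S : ColoredSetup d) {T : Simplex d} (hT : MemM S.T0 T) :
    T.bsv ∉ T.V := fun h => by
  have h1 := vgen_le_gen hd S hT h
  rw [S.vgen_bsv T hT] at h1
  omega

/-- Two members of the master tree of the same generation assign the same convex weights to a
common point; in particular they meet in a common subsimplex. -/
lemma isConvexRep_unique_of_gen_eq (hd : 0 < d) (S : ColoredSetup d) :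
    ∀ (g : ℕ) {T₁ T₂ : Simplex d}, MemM S.T0 T₁ → MemM S.T0 T₂ → T₁.gen = g → T₂.gen = g →
    ∀ {p : Pt d} {B₁ B₂ : Pt d →₀ ℝ}, IsConvexRep T₁.V p B₁ → IsConvexRep T₂.V p B₂ →
      B₁ = B₂ := by
  intro g
  induction g with
  | zero =>
    intro T₁ T₂ h₁ h₂ g₁ g₂ p B₁ B₂ hB₁ hB₂
    have root : ∀ {T : Simplex d}, MemM S.T0 T → T.gen = 0 → T ∈ S.T0 := by
      intro T hT hg
      cases hT with
      | init h => exact h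
      | child _ hc =>
        obtain ⟨s, hs⟩ := hc.isBisected
        have := hs.gen_eq
        omega
    have r₁ := root h₁ g₁
    have r₂ := root h₂ g₂
    have hp : p ∈ T₁.hull ∩ T₂.hull :=
      ⟨Simplex.mem_hull_iff.2 ⟨_, hB₁⟩, Simplex.mem_hull_iff.2 ⟨_, hB₂⟩⟩
    rcases S.conf T₁ r₁ T₂ r₂ with h | ⟨s₁, s₂, -, -, e₁, e₂⟩
    · rw [h] at hp
      exact hp.elim
    · have sub₁ : T₁.vertex '' ↑s₁ ⊆ T₁.V := Set.image_subset_range _ _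
      have sub₂ : T₂.vertex '' ↑s₂ ⊆ T₂.V := Set.image_subset_range _ _
      have hA := vertex_mem_of_convexHull_eq (S.indep T₁ r₁) sub₁ (e₁.symm.trans e₂)
      rw [e₁] at hp
      obtain ⟨B, hB⟩ := (mem_convexHull_iff_isConvexRep (T₁.finite_V.subset sub₁)).1 hp
      rw [isConvexRep_unique (S.indep T₁ r₁) hB₁ (hB.mono sub₁),
        isConvexRep_unique (S.indep T₂ r₂) hB₂ (hB.mono (hA.trans sub₂))]
  | succ g ih =>
    intro T₁ T₂ h₁ h₂ g₁ g₂ p B₁ B₂ hB₁ hB₂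
    have parent : ∀ {T : Simplex d}, MemM S.T0 T → T.gen = g + 1 →
        ∃ P s, MemM S.T0 P ∧ P.gen = g ∧ IsBisected P T s := by
      intro T hT hg
      cases hT with
      | init h =>
        rw [S.gen_zero T h] at hg
        omega
      | @child P _ hP hc =>
        obtain ⟨s, hs⟩ := hc.isBisected
        exact ⟨P, s, hP, by have := hs.gen_eq; omega, hs⟩
    obtain ⟨P₁, s₁, m₁, f₁, b₁⟩ := parent h₁ g₁
    obtain ⟨P₂, s₂, m₂, f₂, b₂⟩ := parent h₂ g₂
    obtain ⟨M₁, j₁, a₁, v₁⟩ := exists_vertexGenerations hd S m₁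
    obtain ⟨M₂, j₂, a₂, v₂⟩ := exists_vertexGenerations hd S m₂
    obtain ⟨C₁, hC₁, rfl⟩ := hB₁.of_bisected v₁ b₁ (bsv_notMem hd S m₁)
    obtain ⟨C₂, hC₂, rfl⟩ := hB₂.of_bisected v₂ b₂ (bsv_notMem hd S m₂)
    obtain rfl := ih m₁ m₂ f₁ f₂ hC₁ hC₂
    have aux : ∀ x y : Pt d, min (C₁ x) (C₁ y) ≠ 0 →
        (x ∈ P₁.V ∧ y ∈ P₁.V) ∧ (x ∈ P₂.V ∧ y ∈ P₂.V) := by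
      intro x y hxy
      have hx : C₁ x ≠ 0 := fun h => hxy (by rw [h]; exact min_eq_left (hC₁.nonneg y))
      have hy : C₁ y ≠ 0 := fun h => hxy (by rw [h]; exact min_eq_right (hC₁.nonneg x))
      exact ⟨⟨not_imp_comm.1 (hC₁.supp x) hx, not_imp_comm.1 (hC₁.supp y) hy⟩,
        ⟨not_imp_comm.1 (hC₂.supp x) hx, not_imp_comm.1 (hC₂.supp y) hy⟩⟩
    by_cases q₁ : min (C₁ (P₁.vertex 0)) (C₁ (P₁.vertex P₁.kIdx)) = 0
    · by_cases q₂ : min (C₁ (P₂.vertex 0)) (C₁ (P₂.vertex P₂.kIdx)) = 0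
      · rw [bisectWeights_of_min_eq_zero q₁, bisectWeights_of_min_eq_zero q₂]
      · obtain ⟨e₁, e₂⟩ := v₂.bse_eq v₁ (f₂.trans f₁.symm) (aux _ _ q₂).1.1 (aux _ _ q₂).1.2
        rw [Simplex.bsv, Simplex.bsv, e₁, e₂]
    · obtain ⟨e₁, e₂⟩ := v₁.bse_eq v₂ (f₁.trans f₂.symm) (aux _ _ q₁).2.1 (aux _ _ q₁).2.2
      rw [Simplex.bsv, Simplex.bsv, e₁, e₂]

/-- The possible vertex values, in units of half the current mesh step, of a hat function on
a simplex whose first `k + 1` vertices belong to the last full uniform refinement. -/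
def StepPattern (k : ℕ) (F : Fin (d + 1) → ℤ) : Prop :=
  (∃ (α β : ℤ) (p : ℕ), -1 ≤ α - β ∧ α - β ≤ 1 ∧
    (∀ i : Fin (d + 1), (i : ℕ) ≤ k → F i = if (i : ℕ) < p then 2 * α else 2 * β) ∧
    (∀ i : Fin (d + 1), k < (i : ℕ) → F i = α + β)) ∨
  (∃ (α β : ℤ) (p : ℕ), k < p ∧ -1 ≤ 2 * α - β ∧ 2 * α - β ≤ 1 ∧
    ∀ i : Fin (d + 1), F i = if (i : ℕ) < p then 2 * α else β)

lemma StepPattern.rescale {F : Fin (d + 1) → ℤ} (h : StepPattern 0 F) :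
    StepPattern d fun i => 2 * F i := by
  left
  rcases h with ⟨α, β, p, h1, h2, hlow, hhigh⟩ | ⟨α, β, p, hp, h1, h2, hF⟩
  · refine ⟨F 0, α + β, 1, ?_, ?_, fun i _ => ?_, fun i hi => absurd i.2 (by omega)⟩
    · rw [hlow 0 le_rfl]
      split_ifs <;> omega
    · rw [hlow 0 le_rfl]
      split_ifs <;> omega
    · split_ifs with hi
      · obtain rfl : i = 0 := Fin.ext (by simpa using hi)
        rfl
      · exact congrArg (2 * ·) (hhigh i (by omega))
  · refine ⟨2 * α, β, p, h1, h2, fun i _ => ?_, fun i hi => absurd i.2 (by omega)⟩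
    simp only [hF i]
    split_ifs <;> ring

lemma StepPattern.bisect {k s : ℕ} {F : Fin (d + 1) → ℤ} (h : StepPattern k F)
    (hk : 0 < k) (hkd : k < d + 1) (hs : s ≤ 1) :
    ∃ c : ℤ, 2 * c = F 0 + F ⟨k, hkd⟩ ∧ ∀ F' : Fin (d + 1) → ℤ,
      (∀ i i' : Fin (d + 1), (i : ℕ) < k → (i' : ℕ) = i + s → F' i = F i') →
      (∀ i : Fin (d + 1), (i : ℕ) = k → F' i = c) →
      (∀ i : Fin (d + 1), k < (i : ℕ) → F' i = F i) →
      StepPattern (k - 1) F' ∧ ∀ i, -1 ≤ c - F' i ∧ c - F' i ≤ 1 := by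
  have constant : ∀ α β : ℤ, ∀ p : ℕ, k < p → -1 ≤ 2 * α - β → 2 * α - β ≤ 1 →
      (∀ i : Fin (d + 1), F i = if (i : ℕ) < p then 2 * α else β) →
      ∃ c : ℤ, 2 * c = F 0 + F ⟨k, hkd⟩ ∧ ∀ F' : Fin (d + 1) → ℤ,
      (∀ i i' : Fin (d + 1), (i : ℕ) < k → (i' : ℕ) = i + s → F' i = F i') →
      (∀ i : Fin (d + 1), (i : ℕ) = k → F' i = c) →
      (∀ i : Fin (d + 1), k < (i : ℕ) → F' i = F i) →
      StepPattern (k - 1) F' ∧ ∀ i, -1 ≤ c - F' i ∧ c - F' i ≤ 1 := by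
    intro α β p hp h1 h2 hF
    refine ⟨2 * α, ?_, fun F' low mid high => ?_⟩
    · rw [hF, hF, if_pos hp, if_pos (show ((0 : Fin (d + 1)) : ℕ) < p from by simp; omega)]
      ring
    · have hF' : ∀ i : Fin (d + 1), F' i = if (i : ℕ) < p then 2 * α else β := by
        intro i
        rcases lt_trichotomy (i : ℕ) k with hi | hi | hi
        · rw [low i ⟨i + s, by omega⟩ hi rfl, hF, if_pos (by simp only; omega),
            if_pos (by omega)]
        · rw [mid i hi, if_pos (by omega)]
        · rw [high i hi, hF]
      refine ⟨Or.inr ⟨α, β, p, by omega, h1, h2, hF'⟩, fun i => ?_⟩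
      rw [hF']
      split_ifs <;> omega
  rcases h with ⟨α, β, p, h1, h2, hlow, hhigh⟩ | ⟨α, β, p, hp, h1, h2, hF⟩
  · by_cases hpk : k < p
    · refine constant α (α + β) (k + 1) (by omega) (by omega) (by omega) fun i => ?_
      by_cases hi : (i : ℕ) ≤ k
      · rw [hlow i hi, if_pos (by omega), if_pos (by omega)]
      · rw [hhigh i (by omega), if_neg (by omega)]
    by_cases hp0 : p = 0
    · refine constant β (α + β) (k + 1) (by omega) (by omega) (by omega) fun i => ?_
      by_cases hi : (i : ℕ) ≤ k
      · rw [hlow i hi, if_neg (by omega), if_pos (by omega)]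
      · rw [hhigh i (by omega), if_neg (by omega)]
    refine ⟨α + β, ?_, fun F' low mid high => ?_⟩
    · rw [hlow 0 (by simp), hlow ⟨k, hkd⟩ le_rfl, if_neg hpk,
        if_pos (show ((0 : Fin (d + 1)) : ℕ) < p from by simp; omega)]
      ring
    · have low' : ∀ i : Fin (d + 1), (i : ℕ) ≤ k - 1 →
          F' i = if (i : ℕ) < p - s then 2 * α else 2 * β := by
        intro i hi
        rw [low i ⟨i + s, by omega⟩ (by omega) rfl, hlow _ (by simp only; omega)]
        exact if_congr (by simp only; omega) rfl rfl
      have high' : ∀ i : Fin (d + 1), k - 1 < (i : ℕ) → F' i = α + β := by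
        intro i hi
        by_cases hik : (i : ℕ) = k
        · exact mid i hik
        · rw [high i (by omega), hhigh i (by omega)]
      refine ⟨Or.inl ⟨α, β, p - s, h1, h2, low', high'⟩, fun i => ?_⟩
      by_cases hi : (i : ℕ) ≤ k - 1
      · rw [low' i hi]
        split_ifs <;> omega
      · rw [high' i (by omega)]
        omega
  · exact constant α β p hp h1 h2 hF

/-- `φ` is the hat function of the vertex `v₀` in the uniform refinement of level `m`. -/
structure IsHat (S : ColoredSetup d) (m : ℕ) (v₀ : Pt d) (φ : Pt d → ℝ) : Prop where
  apply_eq : ∀ {T : Simplex d}, MemM S.T0 T → T.gen = m * d → ∀ {p : Pt d} {B : Pt d →₀ ℝ},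
    IsConvexRep T.V p B → φ p = B v₀

lemma exists_isHat (hd : 0 < d) (S : ColoredSetup d) (m : ℕ) (v₀ : Pt d) :
    ∃ φ, IsHat S m v₀ φ := by
  classical
  let P : Pt d → (Pt d →₀ ℝ) → Prop := fun p B =>
    ∃ T, MemM S.T0 T ∧ T.gen = m * d ∧ IsConvexRep T.V p B
  refine ⟨fun p => if h : ∃ B, P p B then h.choose v₀ else 0, ⟨?_⟩⟩
  intro T hT hg p B hB
  have h : ∃ B, P p B := ⟨B, T, hT, hg, hB⟩
  obtain ⟨T', hT', hg', hB'⟩ := h.choose_spec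
  simp only [dif_pos h]
  rw [isConvexRep_unique_of_gen_eq hd S (m * d) hT' hT hg' hg hB' hB]

namespace IsHat

variable {S : ColoredSetup d} {m : ℕ} {v₀ : Pt d} {φ : Pt d → ℝ}

lemma vertex (h : IsHat S m v₀ φ) {T : Simplex d} (hT : MemM S.T0 T) (hg : T.gen = m * d)
    {x : Pt d} (hx : x ∈ T.V) : φ x = if x = v₀ then 1 else 0 := by
  classical
  rw [h.apply_eq hT hg (IsConvexRep.single hx), Finsupp.single_apply]

lemma midpoint (h : IsHat S m v₀ φ) {T : Simplex d} (hT : MemM S.T0 T) (hg : T.gen = m * d)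
    {p q : Pt d} (hp : p ∈ T.hull) (hq : q ∈ T.hull) :
    φ (midpoint ℝ p q) = (φ p + φ q) / 2 := by
  obtain ⟨B, hB⟩ := Simplex.mem_hull_iff.1 hp
  obtain ⟨C, hC⟩ := Simplex.mem_hull_iff.1 hq
  rw [h.apply_eq hT hg (hB.midpoint hC), h.apply_eq hT hg hB, h.apply_eq hT hg hC]
  simp only [Finsupp.add_apply, Finsupp.smul_apply, smul_eq_mul]
  ring

end IsHat

/-- The values of `φ` at the vertices of a simplex below the uniform refinement of level `m`. -/
structure HatValues (S : ColoredSetup d) (m : ℕ) (φ : Pt d → ℝ) (T : Simplex d) : Prop where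
  pattern : ∃ (n j : ℕ) (F : Fin (d + 1) → ℤ), T.gen = (m + n) * d + j ∧ j < d ∧
    StepPattern (d - j) F ∧ ∀ i, φ (T.vertex i) = F i * (1 / 2 : ℝ) ^ (n + 1)
  lattice : ∀ (i : Fin (d + 1)) (n : ℕ), S.vgen (T.vertex i) ≤ ((m + n) * d : ℕ) →
    ∃ z : ℤ, φ (T.vertex i) = z * (1 / 2 : ℝ) ^ n
  edge : ∀ (i i' : Fin (d + 1)) (n : ℕ), (((m + n) * d : ℕ) : ℤ) < S.vgen (T.vertex i) →
    |φ (T.vertex i) - φ (T.vertex i')| ≤ (1 / 2 : ℝ) ^ (n + 1)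
  sub : ∃ T₀, MemM S.T0 T₀ ∧ T₀.gen = m * d ∧ T.V ⊆ T₀.hull

lemma HatValues.of_gen_eq (hd : 0 < d) {S : ColoredSetup d} {m : ℕ} {v₀ : Pt d}
    {φ : Pt d → ℝ} (hφ : IsHat S m v₀ φ) (hv₀ : S.vgen v₀ ≤ (m : ℤ) * d - d)
    {T : Simplex d} (hT : MemM S.T0 T) (hg : T.gen = m * d) : HatValues S m φ T := by
  have hval : ∀ i, φ (T.vertex i) = if T.vertex i = v₀ then 1 else 0 := fun i =>
    hφ.vertex hT hg (T.vertex_mem i)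
  obtain ⟨M, j, a, hV⟩ := exists_vertexGenerations hd S hT
  have hj : j = 0 := by
    have h1 := hV.gen_eq
    have h2 := hV.lt
    rw [hg] at h1
    have h3 := congrArg (· % d) h1
    simpa [Nat.add_comm, Nat.mod_eq_of_lt h2] using h3.symm
  have hM : M = m := by
    have h1 := hV.gen_eq
    rw [hg, hj, add_zero] at h1
    exact (Nat.eq_of_mul_eq_mul_right hd h1).symm
  subst hj hM
  have ha : a = 0 := Nat.le_zero.1 hV.le
  subst ha
  have hne : ∀ i : Fin (d + 1), 0 < (i : ℕ) → T.vertex i ≠ v₀ := by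
    intro i hi h
    have h1 := hV.old i (by omega) (by omega)
    have := i.2
    rw [h] at h1
    push_cast at h1
    omega
  refine ⟨⟨0, 0, fun i => if T.vertex i = v₀ then 2 else 0, by simpa using hg, hd,
    Or.inl ⟨if T.vertex 0 = v₀ then 1 else 0, 0, 1, ?_, ?_, ?_, ?_⟩, fun i => ?_⟩,
    fun i n _ => ?_, fun i i' n hn => ?_, T, hT, hg, T.V_subset_hull⟩
  · split_ifs <;> norm_num
  · split_ifs <;> norm_num
  · intro i _
    by_cases hi : (i : ℕ) = 0
    · obtain rfl : i = 0 := Fin.ext hi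
      simp
    · simp only [if_neg (hne i (by omega))]
      rw [if_neg (by omega)]
      rfl
  · intro i hi
    have := i.2
    omega
  · simp only [hval]
    by_cases hi : T.vertex i = v₀
    · rw [if_pos hi, if_pos hi]
      norm_num
    · rw [if_neg hi, if_neg hi]
      norm_num
  · rw [hval]
    split_ifs
    · refine ⟨2 ^ n, ?_⟩
      push_cast
      rw [← mul_pow]
      norm_num
    · exact ⟨0, by simp⟩
  · have h1 := hV.vgen_le_gen i
    rw [hg] at h1
    have h2 : M * d ≤ (M + n) * d := Nat.mul_le_mul_right d (by omega)
    omega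

lemma HatValues.child {S : ColoredSetup d} {m : ℕ} {v₀ : Pt d}
    {φ : Pt d → ℝ} (hφ : IsHat S m v₀ φ) {T T' : Simplex d} {s : ℕ} (hT : MemM S.T0 T)
    (h : HatValues S m φ T) (hb : IsBisected T T' s) : HatValues S m φ T' := by
  obtain ⟨n, j, F, hg, hj, hF, hval⟩ := h.pattern
  obtain ⟨T₀, hT₀, hg₀, hsub⟩ := h.sub
  have hd : 0 < d := by omega
  have hk : T.k = d - j := Simplex.k_eq hg hj
  have hkd : T.k < d + 1 := by omega
  have hs := hb.le_one
  rw [← hk] at hF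
  obtain ⟨c, hc, hF'⟩ := hF.bisect (s := s) (by omega) hkd hs
  have hbsv : φ T.bsv = c * (1 / 2 : ℝ) ^ (n + 1) := by
    have e1 : φ T.bsv = (φ (T.vertex 0) + φ (T.vertex T.kIdx)) / 2 :=
      hφ.midpoint hT₀ hg₀ (hsub (T.vertex_mem 0)) (hsub (T.vertex_mem _))
    have e2 : (2 * c : ℝ) = F 0 + F T.kIdx := by exact_mod_cast hc
    rw [e1, hval, hval, ← add_mul, ← e2]
    ring
  have hvgen : S.vgen T.bsv = (((m + n) * d + j : ℕ) : ℤ) + 1 := by rw [S.vgen_bsv T hT, hg]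
  set F' : Fin (d + 1) → ℤ := fun i =>
    if hi : (i : ℕ) < T.k then F ⟨i + s, by omega⟩ else if (i : ℕ) = T.k then c else F i
    with hF'def
  have low : ∀ i i' : Fin (d + 1), (i : ℕ) < T.k → (i' : ℕ) = i + s → F' i = F i' := by
    intro i i' hi hi'
    have : i' = ⟨i + s, by omega⟩ := Fin.ext hi'
    rw [this]
    simp only [hF'def, dif_pos hi]
  have mid : ∀ i : Fin (d + 1), (i : ℕ) = T.k → F' i = c := by
    intro i hi
    simp only [hF'def, hi, lt_irrefl, dite_false, if_true]
  have high : ∀ i : Fin (d + 1), T.k < (i : ℕ) → F' i = F i := by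
    intro i hi
    simp only [hF'def, dif_neg (not_lt.2 hi.le), if_neg hi.ne']
  obtain ⟨hpat, hdiff⟩ := hF' F' low mid high
  have hval' : ∀ i, φ (T'.vertex i) = F' i * (1 / 2 : ℝ) ^ (n + 1) := by
    intro i
    rcases lt_trichotomy (i : ℕ) T.k with hi | hi | hi
    · rw [low i ⟨i + s, by omega⟩ hi rfl, hb.low i ⟨i + s, by omega⟩ hi rfl, hval]
    · rw [mid i hi, hb.mid i hi, hbsv]
    · rw [high i hi, hb.high i hi, hval]
  have hedge : ∀ i n', (((m + n') * d : ℕ) : ℤ) < (((m + n) * d + j : ℕ) : ℤ) + 1 →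
      |φ T.bsv - φ (T'.vertex i)| ≤ (1 / 2 : ℝ) ^ (n' + 1) := by
    intro i n' hn'
    have hle : n' ≤ n := by
      have h1 : (m + n') * d < (m + n + 1) * d := by
        rw [Nat.succ_mul]
        omega
      have := Nat.lt_of_mul_lt_mul_right h1
      omega
    have h2 : |(c : ℝ) - F' i| ≤ 1 := by
      rw [abs_le]
      have := hdiff i
      exact ⟨by exact_mod_cast this.1, by exact_mod_cast this.2⟩
    rw [hbsv, hval', ← sub_mul, abs_mul, abs_of_pos (by positivity : (0 : ℝ) < (1 / 2) ^ (n + 1))]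
    calc |(c : ℝ) - F' i| * (1 / 2) ^ (n + 1) ≤ 1 * (1 / 2) ^ (n + 1) := by gcongr
      _ ≤ (1 / 2) ^ (n' + 1) := by
        rw [one_mul]
        exact pow_le_pow_of_le_one (by norm_num) (by norm_num) (by omega)
  have hgenle : ∀ l : Fin (d + 1), S.vgen (T.vertex l) ≤ (((m + n) * d + j : ℕ) : ℤ) := by
    intro l
    have := vgen_le_gen hd S hT (T.vertex_mem l)
    rwa [hg] at this
  refine ⟨?_, fun i n' hi => ?_, fun i i' n' hi => ?_, T₀, hT₀, hg₀, ?_⟩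
  · by_cases hj' : j + 1 < d
    · refine ⟨n, j + 1, F', by rw [hb.gen_eq, hg, add_assoc], hj', ?_, hval'⟩
      rwa [hk, Nat.sub_sub] at hpat
    · have hjd : j + 1 = d := by omega
      have hk1 : T.k - 1 = 0 := by omega
      rw [hk1] at hpat
      refine ⟨n + 1, 0, fun i => 2 * F' i, ?_, hd, hpat.rescale, fun i => ?_⟩
      · rw [hb.gen_eq, hg, add_assoc, hjd, ← add_assoc, Nat.succ_mul, add_zero]
      · rw [hval']
        push_cast
        ring
  · rcases hb.mem_V i with ⟨e, -⟩ | ⟨l, hl⟩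
    · rw [e, hvgen] at hi
      have hlt : n + 1 ≤ n' := by
        have h1 : (m + n) * d < (m + n') * d := by omega
        have := Nat.lt_of_mul_lt_mul_right h1
        omega
      obtain ⟨r, rfl⟩ := Nat.exists_eq_add_of_le hlt
      refine ⟨c * 2 ^ r, ?_⟩
      rw [e, hbsv, pow_add _ (n + 1) r]
      push_cast
      have : (2 : ℝ) ^ r * (1 / 2) ^ r = 1 := by rw [← mul_pow]; norm_num
      linear_combination (-(c : ℝ) * (1 / 2) ^ (n + 1)) * this
    · rw [← hl] at hi ⊢
      exact h.lattice l n' hi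
  · rcases hb.mem_V i with ⟨e, -⟩ | ⟨l, hl⟩
    · rw [e, hvgen] at hi
      rw [e]
      exact hedge i' n' hi
    · have hl' := hgenle l
      rw [hl] at hl'
      rcases hb.mem_V i' with ⟨e', -⟩ | ⟨l', hl''⟩
      · rw [e', abs_sub_comm]
        exact hedge i n' (by omega)
      · rw [← hl, ← hl'']
        rw [← hl] at hi
        exact h.edge l l' n' hi
  · rintro _ ⟨i, rfl⟩
    rcases hb.mem_V i with ⟨e, -⟩ | h'
    · rw [e]
      exact (convex_convexHull ℝ _).midpoint_mem (hsub (T.vertex_mem _)) (hsub (T.vertex_mem _))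
    · exact hsub h'

lemma hatValues (hd : 0 < d) {S : ColoredSetup d} {m : ℕ} {v₀ : Pt d}
    {φ : Pt d → ℝ} (hφ : IsHat S m v₀ φ) (hv₀ : S.vgen v₀ ≤ (m : ℤ) * d - d)
    {T : Simplex d} (hT : MemM S.T0 T) (hg : m * d ≤ T.gen) : HatValues S m φ T := by
  induction hT with
  | @init T h =>
    exact .of_gen_eq hd hφ hv₀ (.init h) (by have := S.gen_zero T h; omega)
  | @child T T' hT hc ih =>
    obtain ⟨s, hs⟩ := hc.isBisected
    have hgen := hs.gen_eq
    by_cases he : T'.gen = m * d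
    · exact .of_gen_eq hd hφ hv₀ (.child hT hc) he
    · exact (ih (by omega)).child hφ hT hs

lemma exists_child_mem (hd : 0 < d) (T : Simplex d) {x : Pt d} (hx : x ∈ T.V) :
    ∃ T' : Simplex d, T'.IsChild T ∧ T'.gen = T.gen + 1 ∧ x ∈ T'.V := by
  obtain ⟨i, rfl⟩ := hx
  have hkpos : 0 < T.k := Nat.sub_pos_of_lt (Nat.mod_lt _ hd)
  by_cases hi : (i : ℕ) = T.k
  · refine ⟨T.child2, Or.inr rfl, rfl, ⟨⟨i - 1, by omega⟩, ?_⟩⟩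
    exact (isBisected_child2 T).low _ i (by simp only; omega) (by simp only; omega)
  · refine ⟨T.child1, Or.inl rfl, rfl, ⟨i, ?_⟩⟩
    rcases Nat.lt_or_gt_of_ne hi with h | h
    · exact (isBisected_child1 T).low i i h rfl
    · exact (isBisected_child1 T).high i h

lemma exists_descendant_mem (hd : 0 < d) (S : ColoredSetup d) {x : Pt d} (n : ℕ) :
    ∀ {T : Simplex d}, MemM S.T0 T → x ∈ T.V →
      ∃ T', MemM S.T0 T' ∧ T'.gen = T.gen + n ∧ x ∈ T'.V := by
  induction n with
  | zero => exact fun {T} hT hx => ⟨T, hT, rfl, hx⟩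
  | succ n ih =>
    intro T hT hx
    obtain ⟨T₁, h₁, g₁, x₁⟩ := exists_child_mem hd T hx
    obtain ⟨T₂, h₂, g₂, x₂⟩ := ih (.child hT h₁) x₁
    exact ⟨T₂, h₂, by omega, x₂⟩

lemma exists_mem_of_mem_V (hd : 0 < d) (S : ColoredSetup d) (m : ℕ) {T : Simplex d}
    (hT : MemM S.T0 T) {x : Pt d} (hx : x ∈ T.V) :
    ∃ T', MemM S.T0 T' ∧ m * d ≤ T'.gen ∧ x ∈ T'.V := by
  obtain ⟨T', h', g', x'⟩ := exists_descendant_mem hd S (m * d) hT hx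
  exact ⟨T', h', by omega, x'⟩

lemma memM_of_refines {T0 𝒯 : Finset (Simplex d)} (h : Refines T0 𝒯) {T : Simplex d}
    (hT : T ∈ 𝒯) : MemM T0 T := by
  induction h generalizing T with
  | refl => exact .init hT
  | step T₁ _ h₁ ih =>
    rw [Finset.mem_insert, Finset.mem_insert, Finset.mem_erase] at hT
    rcases hT with rfl | rfl | ⟨-, hT⟩
    exacts [.child (ih h₁) (Or.inl rfl), .child (ih h₁) (Or.inr rfl), ih hT]

namespace IsHat

variable {S : ColoredSetup d} {m : ℕ} {v₀ : Pt d} {φ : Pt d → ℝ}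

lemma pos_of_mem_nbhd (hd : 0 < d) (hφ : IsHat S m v₀ φ) {p : Pt d} (hp : p ∈ nbhd S m v₀) : 0 < φ p := by
  classical
  obtain ⟨hp, hbd⟩ := hp
  simp only [Set.mem_iUnion] at hp
  obtain ⟨T, hT, hpT⟩ := hp
  obtain ⟨hTM, hg, i, hi⟩ := hT
  obtain ⟨B, hB⟩ := Simplex.mem_hull_iff.1 hpT
  rw [hφ.apply_eq hTM hg hB]
  refine lt_of_le_of_ne (hB.nonneg _) fun h0 => hbd ?_
  obtain ⟨M, j, a, hV⟩ := exists_vertexGenerations hd S hTM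
  have hinj := hV.injective
  have hv1 : φ v₀ = 1 := by
    rw [hφ.vertex hTM hg (x := v₀) ⟨i, hi⟩, if_pos rfl]
  have hsub : T.vertex '' ↑(Finset.univ.erase i) ⊆ T.V := Set.image_subset_range _ _
  have hfin := T.finite_V.subset hsub
  simp only [patchBd, Set.mem_iUnion]
  refine ⟨T, ⟨hTM, hg, i, hi⟩, Finset.univ.erase i, ⟨by simp, fun hcon => ?_⟩, ?_⟩
  · obtain ⟨C, hC⟩ := (mem_convexHull_iff_isConvexRep hfin).1 hcon
    have h1 := hφ.apply_eq hTM hg (hC.mono hsub)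
    rw [hv1] at h1
    by_cases hin : v₀ ∈ T.vertex '' ↑(Finset.univ.erase i)
    · obtain ⟨l, hl, hli⟩ := hin
      have hne : l ≠ i := by simpa using hl
      exact hne (hinj (hli.trans hi.symm))
    · rw [hC.supp _ hin] at h1
      norm_num at h1
  · refine (mem_convexHull_iff_isConvexRep hfin).2 ⟨B, hB.restrict fun x hx => ?_⟩
    by_cases hxV : x ∈ T.V
    · obtain ⟨l, rfl⟩ := hxV
      by_cases hl : l = i
      · rw [hl, hi, ← h0]
      · exact absurd ⟨l, by simp [hl], rfl⟩ hx
    · exact hB.supp x hxV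

lemma eq_zero_of_notMem_nbhd (hφ : IsHat S m v₀ φ) {T : Simplex d} (hT : MemM S.T0 T)
    (hg : T.gen = m * d) {p : Pt d} (hp : p ∈ T.hull) (hout : p ∉ nbhd S m v₀) : φ p = 0 := by
  obtain ⟨B, hB⟩ := Simplex.mem_hull_iff.1 hp
  by_cases hv : v₀ ∈ T.V
  · have hbd : p ∈ patchBd S m v₀ := by
      by_contra hn
      refine hout ⟨?_, hn⟩
      simp only [Set.mem_iUnion]
      exact ⟨T, ⟨hT, hg, hv⟩, hp⟩
    simp only [patchBd, Set.mem_iUnion] at hbd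
    obtain ⟨T', ⟨hT', hg', -⟩, s, ⟨-, hs⟩, hps⟩ := hbd
    have hsub : T'.vertex '' ↑s ⊆ T'.V := Set.image_subset_range _ _
    obtain ⟨C, hC⟩ := (mem_convexHull_iff_isConvexRep (T'.finite_V.subset hsub)).1 hps
    rw [hφ.apply_eq hT' hg' (hC.mono hsub)]
    exact hC.supp _ fun h => hs (subset_convexHull ℝ _ h)
  · rw [hφ.apply_eq hT hg hB, hB.supp _ hv]

end IsHat

lemma abs_sub_le_of_mem_E (hd : 0 < d) {S : ColoredSetup d} {m n : ℕ} {v₀ a b : Pt d}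
    {φ : Pt d → ℝ} (hφ : IsHat S m v₀ φ) (hv₀ : S.vgen v₀ ≤ (m : ℤ) * d - d)
    {T : Simplex d} (hT : MemM S.T0 T) (hab : s(a, b) ∈ T.E)
    (hn : (((m + n) * d : ℕ) : ℤ) < S.genE s(a, b)) : |φ a - φ b| ≤ (1 / 2 : ℝ) ^ (n + 1) := by
  have hmn : m * d ≤ (m + n) * d := Nat.mul_le_mul_right d (by omega)
  have aux : ∀ i i' : Fin (d + 1), (((m + n) * d : ℕ) : ℤ) < S.vgen (T.vertex i) →
      |φ (T.vertex i) - φ (T.vertex i')| ≤ (1 / 2 : ℝ) ^ (n + 1) := by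
    intro i i' hi
    have hg := vgen_le_gen hd S hT (T.vertex_mem i)
    exact (hatValues hd hφ hv₀ hT (by omega)).edge i i' n hi
  obtain ⟨i, i', -, h⟩ := hab
  rcases lt_max_iff.1 (show _ < max (S.vgen a) (S.vgen b) from hn) with hlt | hlt
  all_goals
    rcases Sym2.eq_iff.1 h with ⟨rfl, rfl⟩ | ⟨rfl, rfl⟩
  · exact aux _ _ hlt
  · exact aux _ _ hlt
  · rw [abs_sub_comm]
    exact aux _ _ hlt
  · rw [abs_sub_comm]
    exact aux _ _ hlt

lemma le_of_lvlZ_lt (hd : 0 < d) {g m : ℤ} (h : lvlZ d g < m) : g ≤ m * d - d := by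
  have := (Int.ediv_lt_iff_lt_mul (by exact_mod_cast hd)).1 h
  omega

lemma lt_of_lt_lvlZ (hd : 0 < d) {g n : ℤ} (h : n < lvlZ d g) : n * d < g := by
  have := (Int.le_ediv_iff_mul_le (by exact_mod_cast hd)).1 (Int.add_one_le_of_lt h)
  rw [add_mul] at this
  omega

theorem leaving_neighborhood (d : ℕ) (hd : 2 ≤ d) (S : ColoredSetup d)
    (𝒯 : Finset (Simplex d)) (h𝒯 : 𝒯 ∈ Bisec S.T0)
    (N : ℕ) (hN : 1 ≤ N)
    (v : Fin (N + 1) → Pt d) (e : Fin N → Sym2 (Pt d))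
    (hv : ∀ j : Fin (N + 1), v j ∈ verticesOf 𝒯)
    (hedge : ∀ j : Fin N, e j ∈ edgesOf 𝒯)
    (hchain : ∀ j : Fin N, e j = s(v j.castSucc, v j.succ))
    (m : ℕ) (hm : S.lvlV (v 0) < (m : ℤ))
    (hin : ∀ j : Fin (N + 1), (j : ℕ) < N → v j ∈ nbhd S m (v 0))
    (hout : v (Fin.last N) ∉ nbhd S m (v 0)) :
    S.lvlE (e ⟨N - 1, by omega⟩) < (m : ℤ) + N := by
  have hd0 : 0 < d := by omega
  have hmem : ∀ {T}, T ∈ 𝒯 → MemM S.T0 T := fun hT => memM_of_refines h𝒯.1 hT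
  have hv₀ : S.vgen (v 0) ≤ (m : ℤ) * d - d := le_of_lvlZ_lt hd0 hm
  obtain ⟨φ, hφ⟩ := exists_isHat hd0 S m (v 0)
  by_contra! hcon
  have hpos : ∀ j : Fin (N + 1), (j : ℕ) < N → 0 < φ (v j) := fun j hj =>
    hφ.pos_of_mem_nbhd hd0 (hin j hj)
  have hvert : ∀ j, ∃ T, MemM S.T0 T ∧ HatValues S m φ T ∧ v j ∈ T.V := by
    intro j
    have hj := hv j
    simp only [verticesOf, Set.mem_iUnion] at hj
    obtain ⟨T, hT, hjT⟩ := hj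
    obtain ⟨T', h', g', x'⟩ := exists_mem_of_mem_V hd0 S m (hmem hT) hjT
    exact ⟨T', h', hatValues hd0 hφ hv₀ h' g', x'⟩
  have hlast : φ (v (Fin.last N)) = 0 := by
    obtain ⟨T, -, hH, hT⟩ := hvert (Fin.last N)
    obtain ⟨T₀, h₀, g₀, hsub⟩ := hH.sub
    exact hφ.eq_zero_of_notMem_nbhd h₀ g₀ (hsub hT) hout
  have hfirst : φ (v 0) = 1 := by
    have h0 := (hin 0 (by simp; omega)).1
    simp only [Set.mem_iUnion] at h0
    obtain ⟨T, ⟨hT, hg, hvT⟩, -⟩ := h0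
    rw [hφ.vertex hT hg hvT, if_pos rfl]
  have hstep : ∀ (j : Fin N) (n : ℕ), (((m + n) * d : ℕ) : ℤ) < S.genE (e j) →
      |φ (v j.castSucc) - φ (v j.succ)| ≤ (1 / 2 : ℝ) ^ (n + 1) := by
    intro j n hn
    have hj := hedge j
    simp only [edgesOf, Set.mem_iUnion] at hj
    obtain ⟨T, hT, hjT⟩ := hj
    rw [hchain j] at hjT hn
    exact abs_sub_le_of_mem_E hd0 hφ hv₀ (hmem hT) hjT hn
  have key : ∀ (l i : ℕ) (h : i + 1 + l = N), φ (v ⟨i, by omega⟩) ≤ (1 / 2 : ℝ) ^ (i + 1) := by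
    intro l
    induction l with
    | zero =>
      intro i h
      have h1 := hstep ⟨N - 1, by omega⟩ i (by
        have := lt_of_lt_lvlZ hd0 (show ((m + i : ℕ) : ℤ) < lvlZ d (S.genE (e ⟨N - 1, by omega⟩))
          from lt_of_lt_of_le (by push_cast; omega) hcon)
        exact_mod_cast this)
      have e1 : (⟨N - 1, by omega⟩ : Fin N).castSucc = ⟨i, by omega⟩ :=
        Fin.ext (by simp only [Fin.val_castSucc]; omega)
      have e2 : (⟨N - 1, by omega⟩ : Fin N).succ = Fin.last N :=
        Fin.ext (by simp only [Fin.val_succ, Fin.val_last]; omega)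
      rw [e1, e2, hlast, sub_zero] at h1
      exact (le_abs_self _).trans h1
    | succ l ih =>
      intro i h
      have h1 := ih (i + 1) (by omega)
      have h2 := hpos ⟨i + 1, by omega⟩ (by simp only; omega)
      have h3 : (((m + (i + 1)) * d : ℕ) : ℤ) < S.vgen (v ⟨i + 1, by omega⟩) := by
        by_contra! hle
        obtain ⟨T, -, hH, q, hq⟩ := hvert ⟨i + 1, by omega⟩
        rw [← hq] at hle h1 h2
        obtain ⟨z, hz⟩ := hH.lattice q (i + 1) hle
        have hp : (0 : ℝ) < (1 / 2) ^ (i + 1) := by positivity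
        rw [hz] at h1 h2
        have hz1 : (1 : ℝ) ≤ z := by
          have := pos_of_mul_pos_left h2 hp.le
          exact_mod_cast (Int.cast_pos.1 this : 0 < z)
        rw [pow_succ _ (i + 1)] at h1
        nlinarith
      have h4 := hstep ⟨i, by omega⟩ (i + 1) (by
        rw [hchain]
        exact lt_max_of_lt_right h3)
      have h5 := (abs_le.1 h4).2
      have e1 : (⟨i, by omega⟩ : Fin N).castSucc = ⟨i, by omega⟩ := rfl
      have e2 : (⟨i, by omega⟩ : Fin N).succ = ⟨i + 1, by omega⟩ := rfl
      rw [e1, e2] at h5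
      calc φ (v ⟨i, by omega⟩) ≤ (1 / 2) ^ (i + 1 + 1) + (1 / 2) ^ (i + 1 + 1) := by linarith
        _ = (1 / 2) ^ (i + 1) := by ring
  have h0 := key (N - 1) 0 (by omega)
  have e0 : (⟨0, by omega⟩ : Fin (N + 1)) = 0 := rfl
  rw [e0, hfirst] at h0
  norm_num at h0

end BisecGrading
end
end
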